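/- Let k ≥ 3 and t ≥ 1 be integers. There exists n₀ such that for all n ≥ n₀, the maximum number of edges in a k-uniform hypergraph on n vertices containing no k-uniform linear path of length 2t+2 is exactly C(n−1,k−1) + C(n−2,k−1) + … + C(n−t,k−1) + C(n−t−2,k−2). -/

import Mathlib

/-- A `k`-uniform linear path of length `ℓ`: a list of `k`-sets `F₁, …, F_ℓ` such that
`|F_i ∩ F_{i+1}| = 1` for consecutive sets and `F_i ∩ F_j = ∅` whenever `|i - j| > 1`. -/
def IsLinearPath (k ℓ : ℕ) {n : ℕ} (A : Fin ℓ → Finset (Fin n)) : Prop :=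
  (∀ i, (A i).card = k) ∧
  (∀ i j : Fin ℓ, (j : ℕ) = (i : ℕ) + 1 → (A i ∩ A j).card = 1) ∧
  (∀ i j : Fin ℓ, (i : ℕ) + 1 < (j : ℕ) → Disjoint (A i) (A j))

namespace LinearPath

open Finset

open scoped Classical

/-- Linear paths as lists of edges, most recent edge first. -/
def LPath {n : ℕ} : List (Finset (Fin n)) → Prop
  | [] => True
  | [_] => True
  | e :: f :: l => (e ∩ f).card = 1 ∧ (∀ g ∈ l, Disjoint e g) ∧ LPath (f :: l)

/-- The family `H` contains a linear path with `ℓ` edges. -/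
def HasPath {n : ℕ} (H : Finset (Finset (Fin n))) (ℓ : ℕ) : Prop :=
  ∃ l : List (Finset (Fin n)), LPath l ∧ l.length = ℓ ∧ ∀ e ∈ l, e ∈ H

lemma LPath.get_prop {n : ℕ} {l : List (Finset (Fin n))} (hl : LPath l) :
    (∀ i (h : i + 1 < l.length), (l[i] ∩ l[i + 1]).card = 1) ∧
      ∀ i j (_ : i + 1 < j) (hj : j < l.length), Disjoint l[i] l[j] := by
  induction l with
  | nil => simp
  | cons e l ih =>
    cases l with
    | nil =>
      refine ⟨fun i h => by simp at h, fun i j hij hj => ?_⟩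
      simp at hj; omega
    | cons f l =>
      obtain ⟨h1, h2, h3⟩ := hl
      obtain ⟨ih1, ih2⟩ := ih h3
      refine ⟨fun i h => ?_, fun i j hij hj => ?_⟩
      · cases i with
        | zero => simpa using h1
        | succ i => exact ih1 i (by simpa using h)
      · obtain ⟨j, rfl⟩ : ∃ j', j = j' + 1 := ⟨j - 1, by omega⟩
        cases i with
        | zero =>
          obtain ⟨j, rfl⟩ : ∃ j', j = j' + 1 := ⟨j - 1, by omega⟩
          simp only [List.getElem_cons_zero, List.getElem_cons_succ]
          exact h2 _ (List.getElem_mem _)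
        | succ i => exact ih2 i j (by omega) (by simpa using hj)

lemma HasPath.exists_isLinearPath {n k ℓ : ℕ} {H : Finset (Finset (Fin n))}
    (hH : ∀ e ∈ H, e.card = k) (h : HasPath H ℓ) :
    ∃ A : Fin ℓ → Finset (Fin n), IsLinearPath k ℓ A ∧ ∀ i, A i ∈ H := by
  obtain ⟨l, hl, rfl, hlH⟩ := h
  obtain ⟨h1, h2⟩ := hl.get_prop
  refine ⟨fun i => l[i], ⟨fun i => hH _ (hlH _ (List.getElem_mem _)), fun i j hij => ?_,
    fun i j hij => h2 i j hij j.2⟩, fun i => hlH _ (List.getElem_mem _)⟩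
  have := h1 i (by omega)
  simp only [Fin.getElem_fin]
  simp only [hij]
  exact this

lemma LPath.cons {n : ℕ} {e f : Finset (Fin n)} {l : List (Finset (Fin n))} {y : Fin n}
    (hl : LPath (f :: l)) (hye : y ∈ e) (hyf : y ∈ f) (hef : e ∩ f ⊆ {y})
    (hd : ∀ g ∈ l, Disjoint e g) : LPath (e :: f :: l) := by
  refine ⟨?_, hd, hl⟩
  rw [card_eq_one]
  exact ⟨y, subset_antisymm hef (by simp [hye, hyf])⟩

/-- The set of vertices covered by a list of edges. -/
def verts {n : ℕ} (l : List (Finset (Fin n))) : Finset (Fin n) := l.toFinset.biUnion id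

lemma mem_verts {n : ℕ} {l : List (Finset (Fin n))} {x : Fin n} :
    x ∈ verts l ↔ ∃ e ∈ l, x ∈ e := by
  simp [verts]

lemma card_verts_le {n k : ℕ} {l : List (Finset (Fin n))} (h : ∀ e ∈ l, e.card ≤ k) :
    (verts l).card ≤ l.length * k := by
  refine (card_biUnion_le_card_mul _ _ k (by simpa using h)).trans ?_
  exact Nat.mul_le_mul_right _ (List.toFinset_card_le l)

lemma eq_insert_of_subset {n k : ℕ} {e f : Finset (Fin n)} {b : Fin n} (he : e.card = k + 1)
    (hf : f.card = k) (hfe : f ⊆ e) (hb : b ∈ e) (hbf : b ∉ f) : e = insert b f := by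
  symm
  apply eq_of_subset_of_card_le
  · exact insert_subset hb hfe
  · rw [card_insert_of_notMem hbf]; omega

lemma exists_insert_of_subset {n k : ℕ} {e f : Finset (Fin n)} (he : e.card = k + 1)
    (hf : f.card = k) (hfe : f ⊆ e) : ∃ b ∈ e, b ∉ f ∧ e = insert b f := by
  obtain ⟨b, hb, hbf⟩ : ∃ b ∈ e, b ∉ f := by
    by_contra! h
    have := card_le_card (show e ⊆ f from h)
    omega
  exact ⟨b, hb, hbf, eq_insert_of_subset he hf hfe hb hbf⟩

lemma exists_edge_avoiding {n u d : ℕ} {H : Finset (Finset (Fin n))}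
    (hH : ∀ e ∈ H, e.card = u)
    (hfull : ∀ e ∈ H, ∀ x ∈ e, d < (H.filter fun e' => e.erase x ⊆ e').card)
    {X : Finset (Fin n)} (hX : X.card ≤ d) {y : Fin n} :
    ∀ {e}, e ∈ H → y ∈ e → ∃ e' ∈ H, y ∈ e' ∧ e' ∩ X ⊆ {y} := by
  intro e
  induction hm : ((e ∩ X).erase y).card using Nat.strong_induction_on generalizing e with
  | _ m ih =>
    intro he hy
    rcases ((e ∩ X).erase y).eq_empty_or_nonempty with h0 | ⟨x, hx⟩
    · refine ⟨e, he, hy, fun z hz => ?_⟩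
      by_contra hzy
      have : z ∈ (e ∩ X).erase y := mem_erase.2 ⟨by simpa using hzy, hz⟩
      simp [h0] at this
    · obtain ⟨hxy, hxe, hxX⟩ : x ≠ y ∧ x ∈ e ∧ x ∈ X := by simpa using hx
      have hlt := hfull e he x hxe
      have : ∃ e' ∈ H, e.erase x ⊆ e' ∧ ∃ b ∈ e', b ∉ X ∧ e' = insert b (e.erase x) := by
        by_contra! hcon
        have hsub : (H.filter fun e' => e.erase x ⊆ e') ⊆ X.image fun b => insert b (e.erase x) := by
          intro e' he'
          rw [mem_filter] at he'
          have hc : (e.erase x).card + 1 = u := by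
            rw [card_erase_add_one hxe, hH e he]
          obtain ⟨b, hb, hbf, heq⟩ := exists_insert_of_subset (k := (e.erase x).card)
            (by rw [hH e' he'.1, hc]) rfl he'.2
          rw [mem_image]
          refine ⟨b, ?_, heq.symm⟩
          by_contra hbX
          exact hcon e' he'.1 he'.2 b hb hbX heq
        have := (card_le_card hsub).trans card_image_le
        omega
      obtain ⟨e', he', hsub, b, hb, hbX, heq⟩ := this
      refine ih _ ?_ rfl he' (hsub (mem_erase.2 ⟨hxy.symm, hy⟩))
      rw [← hm]
      apply card_lt_card
      refine ⟨fun z hz => ?_, fun hsub' => ?_⟩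
      · simp only [heq, mem_erase, mem_inter, mem_insert] at hz ⊢
        obtain ⟨h1, h2 | h2, h3⟩ := hz
        · subst h2; exact absurd h3 hbX
        · exact ⟨h1, h2.2, h3⟩
      · have := hsub' hx
        simp only [heq, mem_erase, mem_inter, mem_insert] at this
        obtain ⟨h1, h2 | h2, h3⟩ := this
        · subst h2; exact hbX h3
        · exact h2.1 rfl

lemma hasPath_of_full {n u q : ℕ} (hu : 2 ≤ u) {H : Finset (Finset (Fin n))}
    (hH : ∀ e ∈ H, e.card = u) (hne : H.Nonempty)
    (hfull : ∀ e ∈ H, ∀ x ∈ e, q * u < (H.filter fun e' => e.erase x ⊆ e').card) :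
    HasPath H q := by
  have key : ∀ j ≤ q, ∃ l e y, LPath (e :: l) ∧ l.length = j ∧ y ∈ e ∧ (∀ g ∈ l, y ∉ g) ∧
      ∀ g ∈ e :: l, g ∈ H := by
    intro j
    induction j with
    | zero =>
      intro _
      obtain ⟨e, he⟩ := hne
      obtain ⟨y, hy⟩ : e.Nonempty := by rw [← card_pos, hH e he]; omega
      exact ⟨[], e, y, trivial, rfl, hy, by simp, by simpa using he⟩
    | succ j ih =>
      intro hj
      obtain ⟨l, e, y, hl, hlen, hy, hyl, hlH⟩ := ih (by omega)
      have hX : (verts (e :: l)).card ≤ q * u := by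
        refine (card_verts_le (k := u) fun g hg => (hH g (hlH g hg)).le).trans ?_
        exact Nat.mul_le_mul_right _ (by simp; omega)
      obtain ⟨e', he', hye', hinter⟩ :=
        exists_edge_avoiding hH hfull hX (hlH e (by simp)) hy
      have hnot : ∀ z ∈ e', z ≠ y → ∀ g ∈ e :: l, z ∉ g := by
        intro z hz hzy g hg hzg
        exact hzy (by simpa using hinter (mem_inter.2 ⟨hz, mem_verts.2 ⟨g, hg, hzg⟩⟩))
      obtain ⟨y', hy', hyy⟩ : ∃ y' ∈ e', y' ≠ y := by
        apply exists_mem_ne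
        rw [hH e' he']; omega
      refine ⟨e :: l, e', y', hl.cons hye' hy ?_ ?_, by simp [hlen], hy', hnot y' hy' hyy, ?_⟩
      · intro z hz
        rw [mem_inter] at hz
        by_contra hzy
        exact hnot z hz.1 (by simpa using hzy) e (by simp) hz.2
      · intro g hg
        rw [disjoint_left]
        intro z hz hzg
        by_cases hzy : z = y
        · subst hzy; exact hyl g hg hzg
        · exact hnot z hz hzy g (by simp [hg]) hzg
      · intro g hg
        rcases List.mem_cons.1 hg with rfl | hg
        · exact he'
        · exact hlH g hg
  cases q with
  | zero => exact ⟨[], trivial, rfl, by simp⟩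
  | succ q =>
    obtain ⟨l, e, y, hl, hlen, -, -, hlH⟩ := key q (by omega)
    exact ⟨e :: l, hl, by simp [hlen], hlH⟩

lemma HasPath.mono {n q : ℕ} {H H' : Finset (Finset (Fin n))} (h : H ⊆ H') (hp : HasPath H q) :
    HasPath H' q := by
  obtain ⟨l, h1, h2, h3⟩ := hp
  exact ⟨l, h1, h2, fun e he => h (h3 e he)⟩

/-- A family without a linear path can be charged to its shadow with bounded multiplicity. -/
theorem exists_shadow_assignment {n u q : ℕ} (hu : 2 ≤ u) (H : Finset (Finset (Fin n)))
    (hH : ∀ e ∈ H, e.card = u) (hno : ¬ HasPath H q) :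
    ∃ a : Finset (Fin n) → Finset (Fin n),
      (∀ e ∈ H, a e ⊆ e ∧ (a e).card + 1 = u) ∧
      ∀ f, (H.filter fun e => a e = f).card ≤ q * u := by
  induction H using Finset.strongInduction with
  | H H ih =>
    rcases H.eq_empty_or_nonempty with rfl | hne
    · exact ⟨id, by simp, by simp⟩
    have : ∃ e ∈ H, ∃ x ∈ e, (H.filter fun e' => e.erase x ⊆ e').card ≤ q * u := by
      by_contra! hcon
      exact hno (hasPath_of_full hu hH hne hcon)
    obtain ⟨e, he, x, hx, hle⟩ := this
    set f := e.erase x with hf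
    obtain ⟨a, ha1, ha2⟩ := ih (H.filter fun e' => ¬ f ⊆ e')
      ((filter_ssubset).2 ⟨e, he, by simp [hf, erase_subset]⟩)
      (fun e' he' => hH e' (mem_filter.1 he').1) (fun h => hno (h.mono (filter_subset _ _)))
    refine ⟨fun e' => if f ⊆ e' then f else a e', fun e' he' => ?_, fun g => ?_⟩
    · by_cases h : f ⊆ e'
      · simp only [h, if_true, true_and]
        rw [hf, card_erase_add_one hx, hH e he]
      · simp only [h, if_false]
        exact ha1 e' (mem_filter.2 ⟨he', h⟩)
    · by_cases hg : g = f
      · refine (card_le_card fun e' he' => ?_).trans hle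
        rw [mem_filter] at he' ⊢
        refine ⟨he'.1, ?_⟩
        by_contra h
        have h2 := he'.2
        simp only [h, if_false] at h2
        exact h (hg ▸ h2 ▸ (ha1 e' (mem_filter.2 ⟨he'.1, h⟩)).1)
      · refine (card_le_card fun e' he' => ?_).trans (ha2 g)
        rw [mem_filter] at he' ⊢
        have h2 := he'.2
        by_cases h : f ⊆ e'
        · simp only [h, if_true] at h2
          exact absurd h2.symm hg
        · simp only [h, if_false] at h2
          exact ⟨mem_filter.2 ⟨he'.1, h⟩, h2⟩

/-- The number of `u`-sets containing `A` and contained in `A ∪ W`. -/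
lemma card_filter_superset_le {n : ℕ} (u : ℕ) (A W : Finset (Fin n)) (F : Finset (Finset (Fin n)))
    (hF : ∀ f ∈ F, f.card = u ∧ A ⊆ f ∧ f \ A ⊆ W) : F.card ≤ W.card ^ (u - A.card) := by
  calc F.card ≤ (powersetCard (u - A.card) W).card := by
        refine card_le_card_of_injOn (fun f => f \ A) (fun f hf => ?_) (fun f hf g hg h => ?_)
        · obtain ⟨h1, h2, h3⟩ := hF f hf
          simp only [mem_coe, mem_powersetCard]
          exact ⟨h3, by rw [card_sdiff_of_subset h2, h1]⟩
        · have h1 := (hF f hf).2.1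
          have h2 := (hF g hg).2.1
          simp only at h
          rw [← sdiff_union_of_subset h1, ← sdiff_union_of_subset h2, h]
    _ ≤ _ := by rw [card_powersetCard]; exact Nat.choose_le_pow _ _

lemma card_le_of_not_hasPath {n u q : ℕ} (hu : 2 ≤ u) (W : Finset (Fin n))
    (H : Finset (Finset (Fin n))) (hH : ∀ e ∈ H, e.card = u ∧ e ⊆ W) (hno : ¬ HasPath H q) :
    H.card ≤ q * u * W.card ^ (u - 1) := by
  obtain ⟨a, ha1, ha2⟩ := exists_shadow_assignment hu H (fun e he => (hH e he).1) hno
  have h1 : H.card ≤ q * u * (H.image a).card :=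
    card_le_mul_card_image _ _ (fun f _ => ha2 f)
  refine h1.trans (Nat.mul_le_mul_left _ ?_)
  have := card_filter_superset_le (u - 1) ∅ W (H.image a) (fun f hf => by
    obtain ⟨e, he, rfl⟩ := mem_image.1 hf
    refine ⟨by have := (ha1 e he).2; omega, by simp, ?_⟩
    simpa using (ha1 e he).1.trans (hH e he).2)
  simpa using this

/-- Every vertex of `U` lies in a `u`-set that avoids any prescribed set of at most `K` other
vertices and forms an edge of `H` with each vertex of `S`. -/
def Flex {n : ℕ} (H : Finset (Finset (Fin n))) (S : Finset (Fin n)) (u K : ℕ)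
    (U : Finset (Fin n)) : Prop :=
  ∀ v ∈ U, ∀ X : Finset (Fin n), X.card ≤ K →
    ∃ f : Finset (Fin n), f.card = u ∧ v ∈ f ∧ f ∩ X ⊆ {v} ∧ ∀ c ∈ S, insert c f ∈ H

lemma Flex.extend {n u K : ℕ} {H : Finset (Finset (Fin n))} {S U : Finset (Fin n)}
    (hflex : Flex H S u K U) {l : List (Finset (Fin n))} {e X : Finset (Fin n)} {y c z : Fin n}
    (hl : LPath (e :: l)) (hy : y ∈ e) (hyl : ∀ g ∈ l, y ∉ g) (hyU : y ∈ U)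
    (hX : verts (e :: l) ⊆ X) (hc : c ∈ S) (hcX : c ∈ X) (hcv : c ∉ verts (e :: l))
    (hz : z ∈ U) (hzX : z ∉ X) (hcard : X.card + u + 1 ≤ K) :
    ∃ A B, LPath (B :: A :: e :: l) ∧ A ∈ H ∧ B ∈ H ∧ z ∈ B ∧ (∀ g ∈ A :: e :: l, z ∉ g) ∧
      A ∩ X ⊆ {y, c} ∧ B ∩ X ⊆ {c} ∧ A.card ≤ u + 1 ∧ B.card ≤ u + 1 := by
  obtain ⟨f, hfu, hyf, hfX, hfH⟩ := hflex y hyU (insert z X)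
    ((card_insert_le _ _).trans (by omega))
  obtain ⟨f', hfu', hzf', hfX', hfH'⟩ := hflex z hz (X ∪ f) ((card_union_le _ _).trans (by omega))
  have hmem : ∀ g ∈ e :: l, ∀ x ∈ g, x ∈ X := fun g hg x hx => hX (mem_verts.2 ⟨g, hg, hx⟩)
  have hcv' : ∀ g ∈ e :: l, c ∉ g := fun g hg hx => hcv (mem_verts.2 ⟨g, hg, hx⟩)
  have hyX : y ∈ X := hmem e (by simp) y hy
  have hcy : c ≠ y := fun h => hcv' e (by simp) (h ▸ hy)
  have hzy : z ≠ y := fun h => hzX (h ▸ hyX)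
  have hcz : c ≠ z := fun h => hzX (h ▸ hcX)
  have hf1 : ∀ x ∈ f, x ∈ X → x = y := fun x hx hxX => by
    simpa using hfX (mem_inter.2 ⟨hx, mem_insert_of_mem hxX⟩)
  have hzf : z ∉ f := fun h => hzy (by simpa using hfX (mem_inter.2 ⟨h, mem_insert_self _ _⟩))
  have hf2 : ∀ x ∈ f', x ∈ X → False := fun x hx hxX => by
    have := hfX' (mem_inter.2 ⟨hx, mem_union_left _ hxX⟩)
    rw [mem_singleton] at this
    exact hzX (this ▸ hxX)
  have hf3 : ∀ x ∈ f', x ∈ f → False := fun x hx hxX => by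
    have := hfX' (mem_inter.2 ⟨hx, mem_union_right _ hxX⟩)
    rw [mem_singleton] at this
    exact hzf (this ▸ hxX)
  refine ⟨insert c f, insert c f', ?_, hfH c hc, hfH' c hc, mem_insert_of_mem hzf', ?_, ?_, ?_,
    (card_insert_le _ _).trans (by omega), (card_insert_le _ _).trans (by omega)⟩
  · refine (hl.cons (y := y) (mem_insert_of_mem hyf) hy ?_ ?_).cons (y := c)
      (mem_insert_self _ _) (mem_insert_self _ _) ?_ ?_
    · intro x hx
      obtain ⟨h1, h2⟩ := mem_inter.1 hx
      rcases mem_insert.1 h1 with rfl | h1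
      · exact absurd h2 (hcv' e (by simp))
      · exact mem_singleton.2 (hf1 x h1 (hmem e (by simp) x h2))
    · intro g hg
      rw [disjoint_left]
      intro x hx hxg
      rcases mem_insert.1 hx with rfl | h1
      · exact hcv' g (by simp [hg]) hxg
      · exact hyl g hg (hf1 x h1 (hmem g (by simp [hg]) x hxg) ▸ hxg)
    · intro x hx
      obtain ⟨h1, h2⟩ := mem_inter.1 hx
      rw [mem_singleton]
      rcases mem_insert.1 h1 with rfl | h1
      · rfl
      · rcases mem_insert.1 h2 with rfl | h2
        · rfl
        · exact (hf3 x h1 h2).elim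
    · intro g hg
      rw [disjoint_left]
      intro x hx hxg
      rcases mem_insert.1 hx with rfl | h1
      · exact hcv' g hg hxg
      · exact hf2 x h1 (hmem g hg x hxg)
  · intro g hg hzg
    rcases List.mem_cons.1 hg with rfl | hg
    · rcases mem_insert.1 hzg with h | h
      · exact hcz h.symm
      · exact hzf h
    · exact hzX (hmem g hg z hzg)
  · intro x hx
    obtain ⟨h1, h2⟩ := mem_inter.1 hx
    rcases mem_insert.1 h1 with rfl | h1
    · simp
    · simp [hf1 x h1 h2]
  · intro x hx
    obtain ⟨h1, h2⟩ := mem_inter.1 hx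
    rcases mem_insert.1 h1 with rfl | h1
    · simp
    · exact (hf2 x h1 h2).elim

lemma Flex.extend_many {n u K : ℕ} {H : Finset (Finset (Fin n))} {S U : Finset (Fin n)}
    (hflex : Flex H S u K U) (hU : K < U.card) (T : Finset (Fin n)) :
    T ⊆ S → ∀ (l : List (Finset (Fin n))) (e X : Finset (Fin n)) (y : Fin n),
    LPath (e :: l) → y ∈ e → (∀ g ∈ l, y ∉ g) → y ∈ U → verts (e :: l) ⊆ X → T ⊆ X →
    Disjoint T (verts (e :: l)) → X.card + (2 * u + 2) * T.card + u + 1 ≤ K →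
    (∀ g ∈ e :: l, g ∈ H) →
    ∃ l' e' y', LPath (e' :: l') ∧ l'.length = l.length + 2 * T.card ∧ y' ∈ e' ∧
      (∀ g ∈ l', y' ∉ g) ∧ y' ∈ U ∧ (∀ g ∈ e' :: l', g ∈ H) ∧
      ∀ g ∈ e' :: l', g ∈ e :: l ∨ g ∩ X ⊆ insert y T := by
  induction T using Finset.induction_on with
  | empty =>
    intro _ l e X y hl hy hyl hyU _ _ _ _ hlH
    exact ⟨l, e, y, hl, by simp, hy, hyl, hyU, hlH, fun g hg => Or.inl hg⟩
  | insert c T hcT ih =>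
    intro hTS l e X y hl hy hyl hyU hX hTX hdis hK hlH
    rw [card_insert_of_notMem hcT] at hK ⊢
    obtain ⟨z, hzU, hzX⟩ : ∃ z ∈ U, z ∉ X := by
      by_contra! h
      have := card_le_card (show U ⊆ X from h)
      omega
    have hyv : y ∈ verts (e :: l) := mem_verts.2 ⟨e, by simp, hy⟩
    obtain ⟨A, B, hP, hA, hB, hzB, hzn, hAX, hBX, hAc, hBc⟩ :=
      hflex.extend hl hy hyl hyU hX (hTS (mem_insert_self _ _)) (hTX (mem_insert_self _ _))
        (fun h => disjoint_left.1 hdis (mem_insert_self _ _) h) hzU hzX (by nlinarith)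
    obtain ⟨l', e', y', h1, h2, h3, h4, h5, h6, h7⟩ :=
      ih ((subset_insert _ _).trans hTS) (A :: e :: l) B (X ∪ (A ∪ B)) z hP hzB hzn hzU (by
        intro x hx
        obtain ⟨g, hg, hxg⟩ := mem_verts.1 hx
        rcases List.mem_cons.1 hg with rfl | hg
        · simp [hxg]
        rcases List.mem_cons.1 hg with rfl | hg
        · simp [hxg]
        · exact mem_union_left _ (hX (mem_verts.2 ⟨g, hg, hxg⟩)))
        ((subset_insert _ _).trans (hTX.trans subset_union_left)) (by
          rw [disjoint_left]
          intro x hxT hx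
          have hxX : x ∈ X := hTX (mem_insert_of_mem hxT)
          have hxc : x ≠ c := fun h => hcT (h ▸ hxT)
          have hxd := disjoint_left.1 hdis (mem_insert_of_mem hxT)
          obtain ⟨g, hg, hxg⟩ := mem_verts.1 hx
          rcases List.mem_cons.1 hg with rfl | hg
          · exact hxc (by simpa using hBX (mem_inter.2 ⟨hxg, hxX⟩))
          rcases List.mem_cons.1 hg with rfl | hg
          · have := hAX (mem_inter.2 ⟨hxg, hxX⟩)
            rw [mem_insert, mem_singleton] at this
            rcases this with rfl | h
            · exact hxd hyv
            · exact hxc h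
          · exact hxd (mem_verts.2 ⟨g, hg, hxg⟩)) (by
          have h1 := card_union_le X (A ∪ B)
          have h2 := card_union_le A B
          nlinarith) (by
          intro g hg
          rcases List.mem_cons.1 hg with rfl | hg
          · exact hB
          rcases List.mem_cons.1 hg with rfl | hg
          · exact hA
          · exact hlH g hg)
    refine ⟨l', e', y', h1, by rw [h2]; simp; ring, h3, h4, h5, h6, fun g hg => ?_⟩
    rcases h7 g hg with h | h
    · rcases List.mem_cons.1 h with rfl | h
      · exact Or.inr (hBX.trans (by simp))
      rcases List.mem_cons.1 h with rfl | h
      · exact Or.inr (hAX.trans (by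
          intro x hx; simp only [mem_insert, mem_singleton] at hx ⊢; tauto))
      · exact Or.inl h
    · refine Or.inr fun x hx => ?_
      obtain ⟨hxg, hxX⟩ := mem_inter.1 hx
      have := h (mem_inter.2 ⟨hxg, mem_union_left _ hxX⟩)
      rcases mem_insert.1 this with rfl | h
      · exact absurd hxX hzX
      · exact mem_insert_of_mem (mem_insert_of_mem h)

/-- Number of vertices that the connecting argument may have to avoid. -/
def avoidBound (u t : ℕ) : ℕ := (2 * u + 2) * (t + 2) + t + u + 1

lemma Flex.hasPath_of_card_inter_eq_one {n u t : ℕ} {H : Finset (Finset (Fin n))}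
    {S U : Finset (Fin n)} (hflex : Flex H S u (avoidBound u t) U) (hU : avoidBound u t < U.card)
    (hH : ∀ e ∈ H, e.card = u + 1) (hS : S.card = t) {e₁ e₂ : Finset (Fin n)} {y : Fin n}
    (h₁ : e₁ ∈ H) (h₂ : e₂ ∈ H) (hd₁ : Disjoint e₁ S) (hd₂ : Disjoint e₂ S)
    (hi : (e₁ ∩ e₂).card = 1) (hy₂ : y ∈ e₂) (hy₁ : y ∉ e₁) (hyU : y ∈ U) :
    HasPath H (2 * t + 2) := by
  have hv : verts [e₂, e₁] = e₂ ∪ e₁ := by ext; simp [mem_verts]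
  obtain ⟨l', e', y', h1, h2, -, -, -, h6, -⟩ :=
    hflex.extend_many hU S subset_rfl [e₁] e₂ (S ∪ (e₂ ∪ e₁)) y
      ⟨by rwa [inter_comm], by simp, trivial⟩ hy₂ (by simpa using hy₁) hyU
      (by rw [hv]; exact subset_union_right) subset_union_left
      (by rw [hv, disjoint_union_right]; exact ⟨hd₂.symm, hd₁.symm⟩) (by
        have a1 := card_union_le S (e₂ ∪ e₁)
        have a2 := card_union_le e₂ e₁
        rw [hH _ h₁, hH _ h₂] at a2
        rw [hS] at a1 ⊢
        unfold avoidBound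
        nlinarith) (by simp [h₁, h₂])
  exact ⟨e' :: l', h1, by simp [h2, hS]; ring, h6⟩

lemma Flex.hasPath_of_disjoint {n u t : ℕ} (ht : 1 ≤ t) {H : Finset (Finset (Fin n))}
    {S U : Finset (Fin n)} (hflex : Flex H S u (avoidBound u t) U) (hU : avoidBound u t < U.card)
    (hUS : Disjoint U S)
    (hH : ∀ e ∈ H, e.card = u + 1) (hS : S.card = t) {e₁ e₂ : Finset (Fin n)} {y₁ y₂ : Fin n}
    (h₁ : e₁ ∈ H) (h₂ : e₂ ∈ H) (hd₁ : Disjoint e₁ S) (hd₂ : Disjoint e₂ S)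
    (hd : Disjoint e₁ e₂) (hy₁ : y₁ ∈ e₁) (hy₁U : y₁ ∈ U) (hy₂ : y₂ ∈ e₂) (hy₂U : y₂ ∈ U) :
    HasPath H (2 * t + 2) := by
  obtain ⟨s, rfl⟩ : ∃ s, t = s + 1 := ⟨t - 1, by omega⟩
  obtain ⟨c, hc⟩ : S.Nonempty := by rw [← card_pos]; omega
  have hv : verts [e₂] = e₂ := by ext; simp [mem_verts]
  have hTc : (S.erase c).card = s := by rw [card_erase_of_mem hc, hS]; rfl
  set X := S ∪ (e₂ ∪ e₁) with hXdef
  have hXc : X.card ≤ s + 1 + 2 * (u + 1) := by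
    have a1 := card_union_le S (e₂ ∪ e₁)
    have a2 := card_union_le e₂ e₁
    rw [hH _ h₁, hH _ h₂] at a2
    rw [hS] at a1
    rw [hXdef]
    omega
  obtain ⟨l', e', y', h1, h2, h3, h4, h5, h6, h7⟩ :=
    hflex.extend_many hU (S.erase c) (erase_subset _ _) [] e₂ X y₂ trivial hy₂ (by simp) hy₂U
      (by rw [hv, hXdef]; exact subset_union_left.trans subset_union_right)
      ((erase_subset _ _).trans subset_union_left)
      (by rw [hv]; exact (hd₂.mono_right (erase_subset _ _)).symm) (by
        rw [hTc]
        unfold avoidBound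
        nlinarith) (by simp [h₂])
  have hge : ∀ g ∈ e' :: l', Disjoint g e₁ := by
    intro g hg
    rcases h7 g hg with h | h
    · rw [List.mem_singleton] at h
      rw [h]; exact hd.symm
    · rw [disjoint_left]
      intro x hxg hx1
      have := h (mem_inter.2 ⟨hxg, mem_union_right _ (mem_union_right _ hx1)⟩)
      rcases mem_insert.1 this with rfl | h
      · exact disjoint_left.1 hd hx1 hy₂
      · exact disjoint_left.1 hd₁ hx1 (mem_of_mem_erase h)
  have hgc : ∀ g ∈ e' :: l', c ∉ g := by
    intro g hg hcg
    rcases h7 g hg with h | h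
    · rw [List.mem_singleton] at h
      exact disjoint_left.1 hd₂ (h ▸ hcg) hc
    · have := h (mem_inter.2 ⟨hcg, mem_union_left _ hc⟩)
      rcases mem_insert.1 this with rfl | h
      · exact disjoint_left.1 hUS hy₂U hc
      · simp at h
  have hy₁v : y₁ ∉ verts (e' :: l') := fun h => by
    obtain ⟨g, hg, hyg⟩ := mem_verts.1 h
    exact disjoint_left.1 (hge g hg) hyg hy₁
  have hy₁c : c ≠ y₁ := fun h => disjoint_left.1 hUS hy₁U (h ▸ hc)
  have hvc : (verts (e' :: l')).card ≤ (2 * s + 1) * (u + 1) := by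
    refine (card_verts_le (k := u + 1) fun g hg => (hH g (h6 g hg)).le).trans ?_
    refine Nat.mul_le_mul_right _ ?_
    simp [h2, hTc]
  obtain ⟨A, B, hP, hA, hB, hzB, hzn, hAX, hBX, hAc, hBc⟩ :=
    hflex.extend (X := (X ∪ verts (e' :: l')).erase y₁) (c := c) (z := y₁) h1 h3 h4 h5
      (fun x hx => mem_erase.2 ⟨fun h => hy₁v (h ▸ hx), mem_union_right _ hx⟩) hc
      (mem_erase.2 ⟨hy₁c, mem_union_left _ (mem_union_left _ hc)⟩)
      (fun h => by
        obtain ⟨g, hg, hyg⟩ := mem_verts.1 h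
        exact hgc g hg hyg) hy₁U (by simp) (by
        have a1 := card_erase_le (s := X ∪ verts (e' :: l')) (a := y₁)
        have a2 := card_union_le X (verts (e' :: l'))
        unfold avoidBound
        nlinarith)
  have hX1 : ∀ x ∈ e₁, x ≠ y₁ → x ∈ (X ∪ verts (e' :: l')).erase y₁ := fun x hx hxy =>
    mem_erase.2 ⟨hxy, mem_union_left _ (mem_union_right _ (mem_union_right _ hx))⟩
  have hc1 : c ∉ e₁ := fun h => disjoint_left.1 hd₁ h hc
  refine ⟨e₁ :: B :: A :: e' :: l', hP.cons hy₁ hzB ?_ ?_, ?_, ?_⟩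
  · intro x hx
    obtain ⟨hx1, hxB⟩ := mem_inter.1 hx
    by_contra hxy
    rw [mem_singleton] at hxy
    have := hBX (mem_inter.2 ⟨hxB, hX1 x hx1 hxy⟩)
    rw [mem_singleton] at this
    exact hc1 (this ▸ hx1)
  · intro g hg
    rcases List.mem_cons.1 hg with rfl | hg
    · rw [disjoint_left]
      intro x hx1 hxA
      have hxy : x ≠ y₁ := fun h => hzn g (by simp) (h ▸ hxA)
      have := hAX (mem_inter.2 ⟨hxA, hX1 x hx1 hxy⟩)
      rw [mem_insert, mem_singleton] at this
      rcases this with rfl | rfl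
      · exact disjoint_left.1 (hge e' (by simp)) h3 hx1
      · exact hc1 hx1
    · exact (hge g hg).symm
  · simp [h2, hTc]; ring
  · intro g hg
    rcases List.mem_cons.1 hg with rfl | hg
    · exact h₁
    rcases List.mem_cons.1 hg with rfl | hg
    · exact hB
    rcases List.mem_cons.1 hg with rfl | hg
    · exact hA
    · exact h6 g hg

/-- The number of `u`-sets containing `A` and a further vertex of `X`. -/
lemma card_le_of_meets {n : ℕ} (u : ℕ) (A X : Finset (Fin n)) (F : Finset (Finset (Fin n)))
    (hF : ∀ f ∈ F, f.card = u ∧ A ⊆ f ∧ ∃ x ∈ X, x ∉ A ∧ x ∈ f) :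
    F.card ≤ X.card * n ^ (u - A.card - 1) := by
  have h1 : F ⊆ (X \ A).biUnion fun x => F.filter fun f => x ∈ f := by
    intro f hf
    obtain ⟨-, -, x, hx, hxA, hxf⟩ := hF f hf
    exact mem_biUnion.2 ⟨x, mem_sdiff.2 ⟨hx, hxA⟩, mem_filter.2 ⟨hf, hxf⟩⟩
  refine (card_le_card h1).trans ((card_biUnion_le_card_mul _ _ _ fun x hx => ?_).trans
    (Nat.mul_le_mul_right _ (card_le_card sdiff_subset)))
  have := card_filter_superset_le u (insert x A) univ (F.filter fun f => x ∈ f) (fun f hf => by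
    obtain ⟨hf, hxf⟩ := mem_filter.1 hf
    obtain ⟨h1, h2, -⟩ := hF f hf
    exact ⟨h1, insert_subset hxf h2, subset_univ _⟩)
  rwa [card_univ, Fintype.card_fin, card_insert_of_notMem (mem_sdiff.1 hx).2,
    ← Nat.sub_sub] at this

/-- The `u`-sets forming an edge of `H` with each vertex of `S`. -/
def commonLink {n : ℕ} (H : Finset (Finset (Fin n))) (S : Finset (Fin n)) (u : ℕ) :
    Finset (Finset (Fin n)) :=
  (powersetCard u univ).filter fun f => Disjoint f S ∧ ∀ c ∈ S, insert c f ∈ H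

/-- The vertices of large degree in the common link of `S`. -/
noncomputable def richVerts {n : ℕ} (H : Finset (Finset (Fin n))) (S : Finset (Fin n)) (u : ℕ)
    (η : ℝ) : Finset (Fin n) :=
  univ.filter fun v => η * (n : ℝ) ^ (u - 1) ≤ ((commonLink H S u).filter fun f => v ∈ f).card

/-- The `u`-sets outside `S` that meet `U` and lie in an edge of `H` outside `S`. -/
def outerLink {n : ℕ} (H : Finset (Finset (Fin n))) (S U : Finset (Fin n)) (u : ℕ) :
    Finset (Finset (Fin n)) :=
  (powersetCard u univ).filter fun f =>
    Disjoint f S ∧ ¬ Disjoint f U ∧ ∃ c, c ∉ S ∧ c ∉ f ∧ insert c f ∈ H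

lemma mem_commonLink {n u : ℕ} {H : Finset (Finset (Fin n))} {S f : Finset (Fin n)} :
    f ∈ commonLink H S u ↔ f.card = u ∧ Disjoint f S ∧ ∀ c ∈ S, insert c f ∈ H := by
  simp [commonLink, mem_powersetCard]

lemma mem_outerLink {n u : ℕ} {H : Finset (Finset (Fin n))} {S U f : Finset (Fin n)} :
    f ∈ outerLink H S U u ↔ f.card = u ∧ Disjoint f S ∧ ¬ Disjoint f U ∧
      ∃ c, c ∉ S ∧ c ∉ f ∧ insert c f ∈ H := by
  simp [outerLink, mem_powersetCard]

lemma flex_richVerts {n u K : ℕ} (hu : 2 ≤ u) {H : Finset (Finset (Fin n))} {S : Finset (Fin n)}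
    {η : ℝ} (hn : (K : ℝ) < η * n) : Flex H S u K (richVerts H S u η) := by
  intro v hv X hX
  simp only [richVerts, mem_filter, mem_univ, true_and] at hv
  by_contra! hcon
  have h1 := card_le_of_meets u {v} X ((commonLink H S u).filter fun f => v ∈ f) (fun f hf => by
    obtain ⟨hf, hvf⟩ := mem_filter.1 hf
    obtain ⟨h1, h2, h3⟩ := mem_commonLink.1 hf
    refine ⟨h1, by simpa using hvf, ?_⟩
    by_contra! h
    obtain ⟨c, hc, hcH⟩ := hcon f h1 hvf (fun x hx => by
      by_contra hxv
      exact h x (mem_inter.1 hx).2 hxv (mem_inter.1 hx).1)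
    exact hcH (h3 c hc))
  obtain ⟨w, rfl⟩ : ∃ w, u = w + 2 := ⟨u - 2, by omega⟩
  have hn0 : 0 < n := Fin.pos v
  have h2 : η * (n : ℝ) ^ (w + 1) ≤ K * (n : ℝ) ^ w := by
    refine hv.trans ?_
    have : ((commonLink H S (w + 2)).filter fun f => v ∈ f).card ≤ K * n ^ w := by
      refine h1.trans (Nat.mul_le_mul hX ?_)
      simp
    exact_mod_cast this
  have h3 : (0 : ℝ) < (n : ℝ) ^ w := by positivity
  rw [pow_succ] at h2
  nlinarith

lemma disjoint_richVerts {n u : ℕ} {H : Finset (Finset (Fin n))} {S : Finset (Fin n)}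
    {η : ℝ} (hη : 0 < η) : Disjoint (richVerts H S u η) S := by
  rw [disjoint_left]
  intro v hv hvS
  have hn0 : 0 < n := Fin.pos v
  simp only [richVerts, mem_filter, mem_univ, true_and] at hv
  have : (commonLink H S u).filter (fun f => v ∈ f) = ∅ := by
    rw [filter_eq_empty_iff]
    intro f hf hvf
    exact disjoint_left.1 (mem_commonLink.1 hf).2.1 hvf hvS
  rw [this, card_empty] at hv
  have : 0 < η * (n : ℝ) ^ (u - 1) := by positivity
  simp at hv
  linarith

lemma card_outerLink_le {n u t : ℕ} (ht : 1 ≤ t) {H : Finset (Finset (Fin n))}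
    {S U : Finset (Fin n)} (hflex : Flex H S u (avoidBound u t) U) (hU : avoidBound u t < U.card)
    (hUS : Disjoint U S) (hH : ∀ e ∈ H, e.card = u + 1) (hS : S.card = t)
    (hno : ¬ HasPath H (2 * t + 2)) : (outerLink H S U u).card ≤ (u + 1) * n ^ (u - 1) := by
  rcases (outerLink H S U u).eq_empty_or_nonempty with h0 | ⟨f₁, hf₁⟩
  · simp [h0]
  obtain ⟨hf₁u, hf₁S, hf₁U, c₁, hc₁S, hc₁f, hc₁H⟩ := mem_outerLink.1 hf₁
  obtain ⟨y₁, hy₁, hy₁U⟩ := not_disjoint_iff.1 hf₁U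
  have := card_le_of_meets u ∅ (insert c₁ f₁) (outerLink H S U u) (fun f hf => by
    obtain ⟨hfu, hfS, hfU, c, hcS, hcf, hcH⟩ := mem_outerLink.1 hf
    obtain ⟨y, hy, hyU⟩ := not_disjoint_iff.1 hfU
    refine ⟨hfu, empty_subset _, ?_⟩
    by_contra! hcon
    have hd₁ : Disjoint (insert c₁ f₁) S := disjoint_insert_left.2 ⟨hc₁S, hf₁S⟩
    have hd : Disjoint (insert c f) S := disjoint_insert_left.2 ⟨hcS, hfS⟩
    have hcon' : ∀ x ∈ f, x ∉ insert c₁ f₁ := fun x hx hx1 => hcon x hx1 (by simp) hx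
    apply hno
    by_cases hc : c ∈ insert c₁ f₁
    · refine hflex.hasPath_of_card_inter_eq_one hU hH hS hc₁H hcH hd₁ hd ?_
        (mem_insert_of_mem hy) (hcon' y hy) hyU
      rw [card_eq_one]
      refine ⟨c, subset_antisymm (fun x hx => ?_) (by simp [hc])⟩
      obtain ⟨hx1, hx2⟩ := mem_inter.1 hx
      rcases mem_insert.1 hx2 with rfl | hx2
      · simp
      · exact absurd hx1 (hcon' x hx2)
    · refine hflex.hasPath_of_disjoint ht hU hUS hH hS hc₁H hcH hd₁ hd ?_
        (mem_insert_of_mem hy₁) hy₁U (mem_insert_of_mem hy) hyU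
      rw [disjoint_right]
      intro x hx
      rcases mem_insert.1 hx with rfl | hx
      · exact hc
      · exact hcon' x hx)
  rw [hH _ hc₁H] at this
  simpa using this

lemma card_commonLink_disjoint_le {n u : ℕ} (hu : 2 ≤ u) (H : Finset (Finset (Fin n)))
    (S : Finset (Fin n)) {η : ℝ} (hη : 0 < η) :
    (((commonLink H S u).filter fun f => Disjoint f (richVerts H S u η)).card : ℝ) ≤
      η * (n : ℝ) ^ u := by
  set U := richVerts H S u η with hU
  have hsub : ((commonLink H S u).filter fun f => Disjoint f U) ⊆
      (univ \ U).biUnion fun v => (commonLink H S u).filter fun f => v ∈ f := by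
    intro f hf
    obtain ⟨hf, hfU⟩ := mem_filter.1 hf
    obtain ⟨v, hv⟩ : f.Nonempty := by
      rw [← card_pos, (mem_commonLink.1 hf).1]; omega
    exact mem_biUnion.2 ⟨v, mem_sdiff.2 ⟨mem_univ _, disjoint_left.1 hfU hv⟩,
      mem_filter.2 ⟨hf, hv⟩⟩
  have h2 := (card_le_card hsub).trans card_biUnion_le
  calc (((commonLink H S u).filter fun f => Disjoint f U).card : ℝ)
      ≤ ∑ v ∈ univ \ U, (((commonLink H S u).filter fun f => v ∈ f).card : ℝ) := by
        exact_mod_cast h2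
    _ ≤ ∑ v ∈ univ \ U, η * (n : ℝ) ^ (u - 1) := by
        refine sum_le_sum fun v hv => ?_
        have := (mem_sdiff.1 hv).2
        simp only [hU, richVerts, mem_filter, mem_univ, true_and, not_le] at this
        exact this.le
    _ ≤ n * (η * (n : ℝ) ^ (u - 1)) := by
        rw [sum_const, nsmul_eq_mul]
        refine mul_le_mul_of_nonneg_right ?_ (by positivity)
        have := card_le_univ (univ \ U)
        rw [Fintype.card_fin] at this
        exact_mod_cast this
    _ = η * (n : ℝ) ^ u := by
        obtain ⟨w, rfl⟩ : ∃ w, u = w + 1 := ⟨u - 1, by omega⟩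
        simp only [Nat.add_sub_cancel, pow_succ]; ring

lemma le_card_richVerts {n u : ℕ} (hu : 2 ≤ u) {H : Finset (Finset (Fin n))}
    {S : Finset (Fin n)} {ε η : ℝ} (hn : 0 < n) (hη : 0 < η) (hηε : η ≤ ε / 2)
    (hS : ε * (n : ℝ) ^ u ≤ (commonLink H S u).card) :
    ε / 2 * (n : ℝ) ≤ (richVerts H S u η).card := by
  have h0 := card_commonLink_disjoint_le hu H S hη
  have h1 : ε / 2 * (n : ℝ) ^ u ≤
      ((commonLink H S u).filter fun f => ¬ Disjoint f (richVerts H S u η)).card := by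
    have h3 : (((commonLink H S u).filter fun f => Disjoint f (richVerts H S u η)).card : ℝ) +
        ((commonLink H S u).filter fun f => ¬ Disjoint f (richVerts H S u η)).card =
          (commonLink H S u).card := by
      exact_mod_cast card_filter_add_card_filter_not (s := commonLink H S u) _
    have h4 : η * (n : ℝ) ^ u ≤ ε / 2 * (n : ℝ) ^ u := by gcongr
    linarith
  have h2 := card_le_of_meets u ∅ (richVerts H S u η)
    ((commonLink H S u).filter fun f => ¬ Disjoint f (richVerts H S u η)) (fun f hf => by
      obtain ⟨hf, hfU⟩ := mem_filter.1 hf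
      obtain ⟨y, hy, hyU⟩ := not_disjoint_iff.1 hfU
      exact ⟨(mem_commonLink.1 hf).1, empty_subset _, y, hyU, by simp, hy⟩)
  obtain ⟨w, rfl⟩ : ∃ w, u = w + 1 := ⟨u - 1, by omega⟩
  simp only [card_empty, Nat.sub_zero, Nat.add_sub_cancel] at h2
  have h3 : ε / 2 * (n : ℝ) ^ (w + 1) ≤ (richVerts H S (w + 1) η).card * (n : ℝ) ^ w :=
    h1.trans (by exact_mod_cast h2)
  have h4 : (0 : ℝ) < (n : ℝ) ^ w := by positivity
  rw [pow_succ] at h3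
  by_contra! h5
  nlinarith

/-- A set `S` with a large common link produces many flexible vertices. -/
theorem eventually_flex {u t : ℕ} (hu : 2 ≤ u) (ht : 1 ≤ t) {ε η : ℝ} (hη : 0 < η)
    (hηε : η ≤ ε / 2) : ∀ᶠ n : ℕ in Filter.atTop, ∀ (H : Finset (Finset (Fin n)))
      (S : Finset (Fin n)), (∀ e ∈ H, e.card = u + 1) → ¬ HasPath H (2 * t + 2) → S.card = t →
      ε * (n : ℝ) ^ u ≤ (commonLink H S u).card →
      Flex H S u (avoidBound u t) (richVerts H S u η) ∧
      avoidBound u t < (richVerts H S u η).card ∧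
      ε / 2 * (n : ℝ) ≤ (richVerts H S u η).card ∧
      (outerLink H S (richVerts H S u η) u).card ≤ (u + 1) * n ^ (u - 1) := by
  have h1 := (Filter.tendsto_id.const_mul_atTop hη).comp tendsto_natCast_atTop_atTop
    |>.eventually_gt_atTop ((avoidBound u t : ℕ) : ℝ)
  filter_upwards [h1, Filter.eventually_gt_atTop 0] with n hn hn0 H S hH hno hS hlarge
  simp only [Function.comp, id] at hn
  have hflex := flex_richVerts (H := H) (S := S) hu hn
  have hcard := le_card_richVerts hu hn0 hη hηε hlarge
  have hlt : avoidBound u t < (richVerts H S u η).card := by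
    have : ((avoidBound u t : ℕ) : ℝ) < (richVerts H S u η).card :=
      hn.trans_le ((by gcongr : η * (n : ℝ) ≤ ε / 2 * n).trans hcard)
    exact_mod_cast this
  exact ⟨hflex, hlt, hcard,
    card_outerLink_le ht hflex hlt (disjoint_richVerts hη) hH hS hno⟩

lemma card_superset_mul_choose {n m : ℕ} (A : Finset (Fin n)) :
    ((powersetCard m univ).filter fun M => A ⊆ M).card * n.choose A.card =
      n.choose m * m.choose A.card := by
  rcases lt_or_ge m A.card with h | h
  · rw [Nat.choose_eq_zero_of_lt h, mul_zero, mul_eq_zero, card_eq_zero, filter_eq_empty_iff]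
    left
    intro M hM hAM
    have := card_le_card hAM
    rw [(mem_powersetCard.1 hM).2] at this
    omega
  · have : ((powersetCard m univ).filter fun M => A ⊆ M).card =
        (powersetCard (m - A.card) (univ \ A)).card := by
      refine card_bij' (fun M _ => M \ A) (fun M _ => M ∪ A) ?_ ?_ ?_ ?_
      · intro M hM
        simp only [mem_filter, mem_powersetCard] at hM ⊢
        exact ⟨sdiff_subset_sdiff (subset_univ _) subset_rfl, by
          rw [card_sdiff_of_subset hM.2, hM.1.2]⟩
      · intro M hM
        simp only [mem_filter, mem_powersetCard] at hM ⊢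
        refine ⟨⟨subset_univ _, ?_⟩, subset_union_right⟩
        rw [card_union_of_disjoint ?_, hM.2]
        · omega
        · exact (subset_sdiff.1 hM.1).2
      · intro M hM
        exact sdiff_union_of_subset (mem_filter.1 hM).2
      · intro M hM
        have := (subset_sdiff.1 (mem_powersetCard.1 hM).1).2
        rw [union_sdiff_right, sdiff_eq_self_of_disjoint this]
    rw [this, card_powersetCard, card_sdiff_of_subset (subset_univ _), card_univ,
      Fintype.card_fin, Nat.choose_mul h, mul_comm]

lemma exists_le_choose (a : ℕ) :
    ∃ γ : ℝ, 0 < γ ∧ ∀ᶠ n : ℕ in Filter.atTop, γ * (n : ℝ) ^ a ≤ n.choose a := by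
  refine ⟨1 / (2 ^ a * a.factorial), by positivity, ?_⟩
  filter_upwards [Filter.eventually_ge_atTop (2 * a)] with n hn
  refine le_trans ?_ (Nat.pow_le_choose (α := ℝ) a n)
  have h1 : (n : ℝ) / 2 ≤ ((n + 1 - a : ℕ) : ℝ) := by
    rw [div_le_iff₀ (by norm_num)]
    have : n ≤ (n + 1 - a) * 2 := by omega
    exact_mod_cast this
  calc 1 / (2 ^ a * a.factorial) * (n : ℝ) ^ a = ((n : ℝ) / 2) ^ a / a.factorial := by
        rw [div_pow]; field_simp
    _ ≤ ((n + 1 - a : ℕ) : ℝ) ^ a / a.factorial := by gcongr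

lemma card_uniform_le {n u : ℕ} (G : Finset (Finset (Fin n))) (hG : ∀ f ∈ G, f.card = u) :
    G.card ≤ n ^ u := by
  simpa using card_filter_superset_le u ∅ univ G (fun f hf => ⟨hG f hf, by simp, by simp⟩)

lemma card_inside_le {n u m : ℕ} (G : Finset (Finset (Fin n))) (hG : ∀ f ∈ G, f.card = u)
    {M : Finset (Fin n)} (hM : M.card = m) :
    (G.filter fun f => f ⊆ M).card ≤ m.choose u := by
  rw [← hM, ← card_powersetCard]
  refine card_le_card fun f hf => ?_
  obtain ⟨h1, h2⟩ := mem_filter.1 hf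
  exact mem_powersetCard.2 ⟨h2, hG f h1⟩

/-- Double counting: incidences between members of `P` and the `m`-sets containing them. -/
lemma sum_card_superset {n m a : ℕ} {ι : Type*} (han : a ≤ n) (P : Finset ι)
    (s : ι → Finset (Fin n)) (hs : ∀ i ∈ P, (s i).card = a) :
    ∑ M ∈ powersetCard m (univ : Finset (Fin n)), ((P.filter fun i => s i ⊆ M).card : ℝ) =
      P.card * (n.choose m * m.choose a / n.choose a) := by
  have h0 : (0 : ℝ) < n.choose a := by exact_mod_cast Nat.choose_pos han
  have h1 : ∑ M ∈ powersetCard m (univ : Finset (Fin n)), (P.filter fun i => s i ⊆ M).card =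
      ∑ i ∈ P, ((powersetCard m univ).filter fun M => s i ⊆ M).card :=
    sum_card_bipartiteAbove_eq_sum_card_bipartiteBelow (fun M i => s i ⊆ M)
  have h2 : ∀ i ∈ P, (((powersetCard m univ).filter fun M => s i ⊆ M).card : ℝ) =
      n.choose m * m.choose a / n.choose a := by
    intro i hi
    rw [eq_div_iff h0.ne', ← hs i hi]
    exact_mod_cast card_superset_mul_choose (s i)
  calc _ = ((∑ i ∈ P, ((powersetCard m univ).filter fun M => s i ⊆ M).card : ℕ) : ℝ) := by
        rw [← h1, Nat.cast_sum]
    _ = _ := by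
        push_cast
        rw [sum_congr rfl h2, sum_const, nsmul_eq_mul]

/-- A random `m`-set spans about the expected number of members of `G`, and the lists attached to
these members avoid each other and the `m`-set. -/
theorem exists_sample (u D m : ℕ) : ∃ β : ℝ, 0 < β ∧ ∀ᶠ n : ℕ in Filter.atTop,
    ∀ (G : Finset (Finset (Fin n))) (L : Finset (Fin n) → Finset (Fin n)),
      (∀ f ∈ G, f.card = u ∧ (L f).card ≤ D ∧ Disjoint (L f) f) →
      (∀ c, ((G.filter fun f => c ∈ L f).card : ℝ) ≤ β * (n : ℝ) ^ u) →
      1 / 4 < (m.choose u : ℝ) * G.card / n.choose u →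
      ∃ M : Finset (Fin n), M.card = m ∧
        (m.choose u : ℝ) * G.card / n.choose u - 1 / 4 ≤ (G.filter fun f => f ⊆ M).card ∧
        (∀ f ∈ G, f ⊆ M → Disjoint (L f) M) ∧
        ∀ f ∈ G, ∀ f' ∈ G, f ⊆ M → f' ⊆ M → Disjoint f f' → Disjoint (L f) (L f') := by
  obtain ⟨γ₂, hγ₂, he₂⟩ := exists_le_choose (u + u)
  obtain ⟨γ₁, hγ₁, he₁⟩ := exists_le_choose (u + 1)
  set R : ℝ := (m.choose u : ℝ) with hR
  set B₂ : ℝ := (m.choose (u + u) : ℝ) with hB₂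
  set B₁ : ℝ := (m.choose (u + 1) : ℝ) with hB₁
  have hR0 : 0 ≤ R := by positivity
  have hB₂0 : 0 ≤ B₂ := by positivity
  have hB₁0 : 0 ≤ B₁ := by positivity
  refine ⟨γ₂ / (8 * (R * D * B₂ + 1)), by positivity, ?_⟩
  set β := γ₂ / (8 * (R * D * B₂ + 1)) with hβ
  have hβ0 : 0 < β := by positivity
  have hlim := (Filter.tendsto_id.const_mul_atTop (show (0 : ℝ) < γ₁ / 8 by positivity)).comp
    tendsto_natCast_atTop_atTop |>.eventually_gt_atTop (R * D * B₁)
  filter_upwards [he₂, he₁, hlim, Filter.eventually_ge_atTop m, Filter.eventually_gt_atTop (u + u),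
    Filter.eventually_gt_atTop (u + 1)] with n h₂ h₁ hn hmn hun hun' G L hG hL hpos
  simp only [Function.comp, id] at hn
  have hn0 : (0 : ℝ) < n := by
    have : 0 < n := by omega
    exact_mod_cast this
  have hC2 : (0 : ℝ) < n.choose (u + u) := by exact_mod_cast Nat.choose_pos hun.le
  have hC1 : (0 : ℝ) < n.choose (u + 1) := by exact_mod_cast Nat.choose_pos hun'.le
  have hCm : (0 : ℝ) < n.choose m := by exact_mod_cast Nat.choose_pos hmn
  have hGn : (G.card : ℝ) ≤ (n : ℝ) ^ u := by
    exact_mod_cast card_uniform_le G (fun f hf => (hG f hf).1)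
  set P : Finset (Finset (Fin n) × Finset (Fin n)) :=
    (G ×ˢ G).filter fun p => Disjoint p.1 p.2 ∧ ¬ Disjoint (L p.1) (L p.2) with hP
  set Z : Finset (Σ _ : Finset (Fin n), Fin n) := G.sigma L with hZ
  have hPcard : (P.card : ℝ) ≤ (n : ℝ) ^ u * D * (β * (n : ℝ) ^ u) := by
    have hsub : P ⊆ G.biUnion fun f => (L f).biUnion fun c =>
        (G.filter fun f' => c ∈ L f').image fun f' => (f, f') := by
      intro p hp
      simp only [hP, mem_filter, mem_product] at hp
      obtain ⟨⟨hp1, hp2⟩, -, hp3⟩ := hp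
      obtain ⟨c, hc1, hc2⟩ := not_disjoint_iff.1 hp3
      simp only [mem_biUnion, mem_image, mem_filter]
      exact ⟨p.1, hp1, c, hc1, p.2, ⟨hp2, hc2⟩, rfl⟩
    have h1 : ∀ f ∈ G, (((L f).biUnion fun c =>
        (G.filter fun f' => c ∈ L f').image fun f' => (f, f')).card : ℝ) ≤
          D * (β * (n : ℝ) ^ u) := by
      intro f hf
      calc _ ≤ ∑ c ∈ L f, ((G.filter fun f' => c ∈ L f').card : ℝ) := by
            exact_mod_cast card_biUnion_le.trans (sum_le_sum fun c _ => card_image_le)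
        _ ≤ ∑ c ∈ L f, β * (n : ℝ) ^ u := sum_le_sum fun c _ => hL c
        _ = (L f).card * (β * (n : ℝ) ^ u) := by rw [sum_const, nsmul_eq_mul]
        _ ≤ _ := by
          have := (hG f hf).2.1
          gcongr
    calc (P.card : ℝ) ≤ ∑ f ∈ G, (((L f).biUnion fun c =>
          (G.filter fun f' => c ∈ L f').image fun f' => (f, f')).card : ℝ) := by
          exact_mod_cast (card_le_card hsub).trans card_biUnion_le
      _ ≤ ∑ f ∈ G, D * (β * (n : ℝ) ^ u) := sum_le_sum h1
      _ = G.card * (D * (β * (n : ℝ) ^ u)) := by rw [sum_const, nsmul_eq_mul]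
      _ ≤ (n : ℝ) ^ u * (D * (β * (n : ℝ) ^ u)) := by gcongr
      _ = _ := by ring
  have hZcard : (Z.card : ℝ) ≤ (n : ℝ) ^ u * D := by
    rw [hZ, card_sigma]
    push_cast
    calc ∑ f ∈ G, ((L f).card : ℝ) ≤ ∑ f ∈ G, (D : ℝ) :=
          sum_le_sum fun f hf => by exact_mod_cast (hG f hf).2.1
      _ = G.card * D := by rw [sum_const, nsmul_eq_mul]
      _ ≤ _ := by gcongr
  have hs₀ := sum_card_superset (m := m) (a := u) (by omega) G id (fun f hf => (hG f hf).1)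
  have hs₂ := sum_card_superset (m := m) hun.le P (fun p => p.1 ∪ p.2) (fun p hp => by
    simp only [hP, mem_filter, mem_product] at hp
    rw [card_union_of_disjoint hp.2.1, (hG _ hp.1.1).1, (hG _ hp.1.2).1])
  have hs₁ := sum_card_superset (m := m) hun'.le Z (fun p => insert p.2 p.1) (fun p hp => by
    simp only [hZ, mem_sigma] at hp
    rw [card_insert_of_notMem (disjoint_left.1 (hG _ hp.1).2.2 hp.2), (hG _ hp.1).1])
  have hb₂ : R * (P.card * (n.choose m * B₂ / n.choose (u + u))) ≤ n.choose m * (1 / 8) := by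
    have : R * (P.card * B₂) ≤ 1 / 8 * n.choose (u + u) := by
      calc R * (P.card * B₂) ≤ R * ((n : ℝ) ^ u * D * (β * (n : ℝ) ^ u) * B₂) := by gcongr
        _ = (R * D * B₂) * β * (n : ℝ) ^ (u + u) := by rw [pow_add]; ring
        _ ≤ (γ₂ / 8) * (n : ℝ) ^ (u + u) := by
          gcongr
          rw [hβ, mul_div_assoc', div_le_div_iff₀ (by positivity) (by norm_num)]
          nlinarith
        _ = 1 / 8 * (γ₂ * (n : ℝ) ^ (u + u)) := by ring
        _ ≤ _ := by gcongr
    calc _ = n.choose m * (R * (P.card * B₂) / n.choose (u + u)) := by ring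
      _ ≤ _ := mul_le_mul_of_nonneg_left (by rwa [div_le_iff₀ hC2]) hCm.le
  have hb₁ : R * (Z.card * (n.choose m * B₁ / n.choose (u + 1))) ≤ n.choose m * (1 / 8) := by
    have : R * (Z.card * B₁) ≤ 1 / 8 * n.choose (u + 1) := by
      calc R * (Z.card * B₁) ≤ R * ((n : ℝ) ^ u * D * B₁) := by gcongr
        _ = (R * D * B₁) * (n : ℝ) ^ u := by ring
        _ ≤ (γ₁ / 8 * n) * (n : ℝ) ^ u := by gcongr
        _ = 1 / 8 * (γ₁ * (n : ℝ) ^ (u + 1)) := by rw [pow_succ]; ring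
        _ ≤ _ := by gcongr
    calc _ = n.choose m * (R * (Z.card * B₁) / n.choose (u + 1)) := by ring
      _ ≤ _ := mul_le_mul_of_nonneg_left (by rwa [div_le_iff₀ hC1]) hCm.le
  obtain ⟨M, hM, hle⟩ : ∃ M ∈ powersetCard m (univ : Finset (Fin n)),
      R * G.card / n.choose u - 1 / 4 ≤ ((G.filter fun f => f ⊆ M).card : ℝ) -
        R * (P.filter fun p => p.1 ∪ p.2 ⊆ M).card -
        R * (Z.filter fun p => insert p.2 p.1 ⊆ M).card := by
    apply exists_le_of_sum_le
    · rw [← card_pos, card_powersetCard, card_univ, Fintype.card_fin]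
      exact Nat.choose_pos hmn
    · simp only [id] at hs₀
      rw [sum_const]
      simp only [sum_sub_distrib, ← mul_sum]
      rw [hs₀, hs₁, hs₂, card_powersetCard, card_univ, Fintype.card_fin, nsmul_eq_mul]
      have : (n.choose m : ℝ) * (R * G.card / n.choose u) =
        G.card * (n.choose m * R / n.choose u) := by ring
      linarith
  have hMm := (mem_powersetCard.1 hM).2
  have hle' : ((G.filter fun f => f ⊆ M).card : ℝ) ≤ R := by
    rw [hR]
    exact_mod_cast card_inside_le G (fun f hf => (hG f hf).1) hMm
  set p := (P.filter fun p => p.1 ∪ p.2 ⊆ M) with hp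
  set z := (Z.filter fun p => insert p.2 p.1 ⊆ M) with hz
  have hp0 : p = ∅ := by
    by_contra h
    have h4 : (1 : ℝ) ≤ p.card := by exact_mod_cast card_pos.2 (nonempty_iff_ne_empty.2 h)
    have h5 : 0 ≤ R * z.card := mul_nonneg hR0 (Nat.cast_nonneg _)
    have h6 : R ≤ R * p.card := le_mul_of_one_le_right hR0 h4
    linarith
  have hz0 : z = ∅ := by
    by_contra h
    have h4 : (1 : ℝ) ≤ z.card := by exact_mod_cast card_pos.2 (nonempty_iff_ne_empty.2 h)
    have h5 : 0 ≤ R * p.card := mul_nonneg hR0 (Nat.cast_nonneg _)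
    have h6 : R ≤ R * z.card := le_mul_of_one_le_right hR0 h4
    linarith
  refine ⟨M, hMm, by simpa [hp0, hz0] using hle, fun f hf hfM => ?_,
    fun f hf f' hf' hfM hfM' hd => ?_⟩
  · rw [disjoint_left]
    intro c hc hcM
    have : (⟨f, c⟩ : Σ _ : Finset (Fin n), Fin n) ∈ z := by
      simp only [hz, hZ, mem_filter, mem_sigma]
      exact ⟨⟨hf, hc⟩, insert_subset hcM hfM⟩
    simp [hz0] at this
  · by_contra hdd
    have : (f, f') ∈ p := by
      simp only [hp, hP, mem_filter, mem_product]
      exact ⟨⟨⟨hf, hf'⟩, hd, hdd⟩, union_subset hfM hfM'⟩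
    simp [hp0] at this

/-- Enlarging the edges of a linear path inside `M` by vertices outside `M`. -/
lemma LPath.map_insert {n : ℕ} {M : Finset (Fin n)} {l : List (Finset (Fin n) × Fin n)}
    (hl : LPath (l.map Prod.fst)) (hne : l.IsChain fun p p' => p.2 ≠ p'.2)
    (hM : ∀ p ∈ l, p.1 ⊆ M ∧ p.2 ∉ M)
    (hd : ∀ p ∈ l, ∀ p' ∈ l, Disjoint p.1 p'.1 → p.2 ≠ p'.2) :
    LPath (l.map fun p => insert p.2 p.1) := by
  induction l with
  | nil => exact trivial
  | cons p l ih =>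
    cases l with
    | nil => exact trivial
    | cons p' l =>
      obtain ⟨h1, h2, h3⟩ := hl
      rw [List.isChain_cons_cons] at hne
      refine ⟨?_, ?_, ih h3 hne.2 (fun x hx => hM x (by simp [hx]))
        (fun x hx y hy => hd x (by simp [hx]) y (by simp [hy]))⟩
      · have hp := hM p (by simp)
        have hp' := hM p' (by simp)
        rw [insert_inter_of_notMem, inter_insert_of_notMem (fun h => hp'.2 (hp.1 h)), h1]
        rw [mem_insert, not_or]
        exact ⟨hne.1, fun h => hp.2 (hp'.1 h)⟩
      · intro g hg
        obtain ⟨r, hr, rfl⟩ := List.mem_map.1 hg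
        have hp := hM p (by simp)
        have hr' := hM r (by simp [hr])
        have hdr := h2 r.1 (List.mem_map.2 ⟨r, hr, rfl⟩)
        rw [disjoint_insert_left, disjoint_insert_right, mem_insert, not_or]
        exact ⟨⟨hd p (by simp) r (by simp [hr]) hdr, fun h => hp.2 (hr'.1 h)⟩,
          fun h => hr'.2 (hp.1 h), hdr⟩

lemma exists_distinct_choices {n : ℕ} (L : Finset (Fin n) → Finset (Fin n))
    (l : List (Finset (Fin n))) (hl : ∀ f ∈ l, 2 ≤ (L f).card) :
    ∃ l' : List (Finset (Fin n) × Fin n), l'.map Prod.fst = l ∧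
      (l'.IsChain fun p p' => p.2 ≠ p'.2) ∧ ∀ p ∈ l', p.2 ∈ L p.1 := by
  induction l with
  | nil => exact ⟨[], rfl, by simp, by simp⟩
  | cons f l ih =>
    obtain ⟨l', h1, h2, h3⟩ := ih (fun g hg => hl g (by simp [hg]))
    have hf := hl f (by simp)
    cases l' with
    | nil =>
      obtain ⟨c, hc⟩ : (L f).Nonempty := by rw [← card_pos]; omega
      exact ⟨[(f, c)], by simpa using h1, by simp, by simpa using hc⟩
    | cons p l' =>
      obtain ⟨c, hc, hcp⟩ := exists_mem_ne hf p.2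
      refine ⟨(f, c) :: p :: l', by rw [← h1]; rfl, List.isChain_cons_cons.2 ⟨hcp, h2⟩, ?_⟩
      intro r hr
      rcases List.mem_cons.1 hr with rfl | hr
      · exact hc
      · exact h3 r hr

lemma exists_large_choose {u : ℕ} (hu : 1 ≤ u) (K : ℕ) {ε : ℝ} (hε : 0 < ε) :
    ∃ m : ℕ, 1 ≤ m ∧ K * (m : ℝ) ^ (u - 1) + 1 ≤ m.choose u * ε := by
  obtain ⟨γ, hγ, he⟩ := exists_le_choose u
  have hlim := (Filter.tendsto_id.const_mul_atTop (show (0 : ℝ) < γ * ε by positivity)).comp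
    tendsto_natCast_atTop_atTop |>.eventually_gt_atTop ((K : ℝ) + 1)
  obtain ⟨m, h1, h2, h3⟩ := (he.and (hlim.and (Filter.eventually_ge_atTop 1))).exists
  refine ⟨m, h3, ?_⟩
  simp only [Function.comp, id] at h2
  obtain ⟨w, rfl⟩ : ∃ w, u = w + 1 := ⟨u - 1, by omega⟩
  simp only [Nat.add_sub_cancel]
  have h4 : (1 : ℝ) ≤ (m : ℝ) ^ w := one_le_pow₀ (by exact_mod_cast h3)
  calc K * (m : ℝ) ^ w + 1 ≤ (K + 1) * (m : ℝ) ^ w := by linarith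
    _ ≤ (γ * ε * m) * (m : ℝ) ^ w := by gcongr
    _ = γ * (m : ℝ) ^ (w + 1) * ε := by rw [pow_succ]; ring
    _ ≤ _ := by gcongr

/-- Many `u`-sets with two light extensions each force a long linear path. -/
lemma exists_hasPath_of_light {u : ℕ} (hu : 2 ≤ u) (q D : ℕ) {ε : ℝ} (hε : 0 < ε) :
    ∃ β : ℝ, 0 < β ∧ ∀ᶠ n : ℕ in Filter.atTop, ∀ (H G : Finset (Finset (Fin n)))
      (L : Finset (Fin n) → Finset (Fin n)),
      (∀ f ∈ G, f.card = u ∧ (L f).card ≤ D ∧ 2 ≤ (L f).card ∧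
        ∀ c ∈ L f, c ∉ f ∧ insert c f ∈ H) →
      (∀ c, ((G.filter fun f => c ∈ L f).card : ℝ) ≤ β * (n : ℝ) ^ u) →
      ε * (n : ℝ) ^ u ≤ G.card → HasPath H q := by
  obtain ⟨m, hm1, hm⟩ := exists_large_choose (u := u) (by omega) (q * u) hε
  obtain ⟨β, hβ, hev⟩ := exists_sample u D m
  refine ⟨β, hβ, ?_⟩
  filter_upwards [hev, Filter.eventually_ge_atTop u] with n hn hun H G L hG hL hcard
  have hN : (0 : ℝ) < n.choose u := by exact_mod_cast Nat.choose_pos hun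
  have hratio : m.choose u * ε ≤ (m.choose u : ℝ) * G.card / n.choose u := by
    rw [mul_div_assoc]
    gcongr
    rw [le_div_iff₀ hN]
    refine le_trans ?_ hcard
    gcongr
    exact_mod_cast Nat.choose_le_pow n u
  have hpow : (0 : ℝ) ≤ ((q * u : ℕ) : ℝ) * (m : ℝ) ^ (u - 1) := by positivity
  obtain ⟨M, hM, hGM, hLM, hLL⟩ := hn G L
    (fun f hf => ⟨(hG f hf).1, (hG f hf).2.1,
      disjoint_left.2 fun c hc => ((hG f hf).2.2.2 c hc).1⟩) hL (by linarith)
  have hpath : HasPath (G.filter fun f => f ⊆ M) q := by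
    by_contra hno
    have := card_le_of_not_hasPath hu M _
      (fun f hf => ⟨(hG f (mem_filter.1 hf).1).1, (mem_filter.1 hf).2⟩) hno
    rw [hM] at this
    have : ((G.filter fun f => f ⊆ M).card : ℝ) ≤ ((q * u : ℕ) : ℝ) * (m : ℝ) ^ (u - 1) := by
      exact_mod_cast this
    linarith
  obtain ⟨l, hl, hlen, hlG⟩ := hpath
  have hlG' : ∀ f ∈ l, f ∈ G ∧ f ⊆ M := fun f hf => mem_filter.1 (hlG f hf)
  obtain ⟨l', h1, h2, h3⟩ := exists_distinct_choices L l (fun f hf => (hG f (hlG' f hf).1).2.2.1)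
  have hl' : ∀ p ∈ l', p.1 ∈ G ∧ p.1 ⊆ M := fun p hp =>
    hlG' p.1 (h1 ▸ List.mem_map.2 ⟨p, hp, rfl⟩)
  refine ⟨l'.map fun p => insert p.2 p.1, LPath.map_insert (M := M) (h1 ▸ hl) h2 ?_ ?_, ?_, ?_⟩
  · exact fun p hp => ⟨(hl' p hp).2,
      disjoint_left.1 (hLM p.1 (hl' p hp).1 (hl' p hp).2) (h3 p hp)⟩
  · intro p hp p' hp' hd heq
    exact disjoint_left.1 (hLL p.1 (hl' p hp).1 p'.1 (hl' p' hp').1 (hl' p hp).2 (hl' p' hp').2 hd)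
      (h3 p hp) (heq ▸ h3 p' hp')
  · rw [← hlen, ← h1]; simp
  · intro e he
    obtain ⟨p, hp, rfl⟩ := List.mem_map.1 he
    exact ((hG p.1 (hl' p hp).1).2.2.2 _ (h3 p hp)).2

/-- The vertices that lie in the lists of many members of `G`. -/
noncomputable def heavyVerts {n : ℕ} (G : Finset (Finset (Fin n)))
    (L : Finset (Fin n) → Finset (Fin n)) (b : ℝ) : Finset (Fin n) :=
  univ.filter fun c => b < (G.filter fun f => c ∈ L f).card

lemma card_heavyVerts_le {n u D : ℕ} {G : Finset (Finset (Fin n))}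
    {L : Finset (Fin n) → Finset (Fin n)} {β : ℝ} (hβ : 0 < β) (hn : 0 < n)
    (hG : ∀ f ∈ G, f.card = u ∧ (L f).card ≤ D) :
    (heavyVerts G L (β * (n : ℝ) ^ u)).card ≤ ⌊D / β⌋₊ := by
  set W := heavyVerts G L (β * (n : ℝ) ^ u) with hW
  apply Nat.le_floor
  rw [le_div_iff₀ hβ]
  have hpos : (0 : ℝ) < (n : ℝ) ^ u := by positivity
  have h1 : W.card * (β * (n : ℝ) ^ u) ≤ D * (n : ℝ) ^ u := by
    calc W.card * (β * (n : ℝ) ^ u) = ∑ c ∈ W, β * (n : ℝ) ^ u := by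
          rw [sum_const, nsmul_eq_mul]
      _ ≤ ∑ c ∈ W, ((G.filter fun f => c ∈ L f).card : ℝ) := by
          refine sum_le_sum fun c hc => ?_
          simp only [hW, heavyVerts, mem_filter, mem_univ, true_and] at hc
          exact hc.le
      _ = ((∑ f ∈ G, (W.filter fun c => c ∈ L f).card : ℕ) : ℝ) := by
          have := sum_card_bipartiteAbove_eq_sum_card_bipartiteBelow (s := W) (t := G)
            (fun c f => c ∈ L f)
          simp only [bipartiteAbove, bipartiteBelow] at this
          exact_mod_cast this
      _ ≤ ((G.card * D : ℕ) : ℝ) := by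
          norm_cast
          refine sum_le_card_nsmul _ _ _ fun f hf => ?_
          refine (card_le_card fun c hc => ?_).trans (hG f hf).2
          exact (mem_filter.1 hc).2
      _ ≤ D * (n : ℝ) ^ u := by
          have := card_uniform_le G (fun f hf => (hG f hf).1)
          have : (G.card : ℝ) ≤ (n : ℝ) ^ u := by exact_mod_cast this
          push_cast
          nlinarith [(Nat.cast_nonneg D : (0 : ℝ) ≤ D)]
  nlinarith

lemma exists_popular_subset {n t h : ℕ} {G : Finset (Finset (Fin n))}
    {L : Finset (Fin n) → Finset (Fin n)} {W : Finset (Fin n)} (hW : W.card ≤ h)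
    (hne : G.Nonempty) (hG : ∀ f ∈ G, t ≤ (L f ∩ W).card) :
    ∃ S : Finset (Fin n), S.card = t ∧
      (G.card : ℝ) ≤ 2 ^ h * (G.filter fun f => S ⊆ L f).card := by
  have hex : ∀ f, f ∈ G → ∃ S ⊆ L f ∩ W, S.card = t := fun f hf => exists_subset_card_eq (hG f hf)
  choose! s hs hst using hex
  have hmaps : ∀ f ∈ G, s f ∈ powersetCard t W := fun f hf =>
    mem_powersetCard.2 ⟨(hs f hf).trans inter_subset_right, hst f hf⟩
  have hp : (powersetCard t W).card ≤ 2 ^ h := by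
    calc _ ≤ W.powerset.card := card_le_card fun A hA => mem_powerset.2 (mem_powersetCard.1 hA).1
      _ ≤ 2 ^ h := by rw [card_powerset]; exact Nat.pow_le_pow_right (by norm_num) hW
  obtain ⟨S, hS, hle⟩ := exists_le_card_fiber_of_nsmul_le_card_of_maps_to (M := ℝ)
    (b := G.card / 2 ^ h) hmaps ⟨_, hmaps _ hne.choose_spec⟩ (by
      rw [nsmul_eq_mul, mul_div_assoc', div_le_iff₀ (by positivity), mul_comm]
      have : ((powersetCard t W).card : ℝ) ≤ 2 ^ h := by exact_mod_cast hp
      gcongr)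
  refine ⟨S, (mem_powersetCard.1 hS).2, ?_⟩
  rw [div_le_iff₀ (by positivity), mul_comm] at hle
  refine hle.trans ?_
  have : (G.filter fun f => s f = S).card ≤ (G.filter fun f => S ⊆ L f).card := by
    refine card_le_card fun f hf => ?_
    obtain ⟨h1, h2⟩ := mem_filter.1 hf
    exact mem_filter.2 ⟨h1, h2 ▸ (hs f h1).trans inter_subset_left⟩
  gcongr

/-- `L` assigns to each `u`-set at most `D` vertices that extend it to an edge of `H`. -/
def IsListing {n : ℕ} (H : Finset (Finset (Fin n))) (u D : ℕ)
    (L : Finset (Fin n) → Finset (Fin n)) : Prop :=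
  ∀ f, f.card = u → (L f).card ≤ D ∧ ∀ c ∈ L f, c ∉ f ∧ insert c f ∈ H

lemma IsListing.mem_commonLink {n u D : ℕ} {H : Finset (Finset (Fin n))}
    {L : Finset (Fin n) → Finset (Fin n)} (hL : IsListing H u D L) {f S : Finset (Fin n)}
    (hf : f.card = u) (hS : S ⊆ L f) : f ∈ commonLink H S u :=
  LinearPath.mem_commonLink.2 ⟨hf, disjoint_right.2 fun _ hc => ((hL f hf).2 _ (hS hc)).1,
    fun _ hc => ((hL f hf).2 _ (hS hc)).2⟩

lemma eventually_lt_mul_pow (K : ℕ) {u : ℕ} (hu : 1 ≤ u) {ε : ℝ} (hε : 0 < ε) :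
    ∀ᶠ n : ℕ in Filter.atTop, (K : ℝ) * (n : ℝ) ^ (u - 1) < ε * (n : ℝ) ^ u := by
  have hlim := (Filter.tendsto_id.const_mul_atTop hε).comp
    tendsto_natCast_atTop_atTop |>.eventually_gt_atTop (K : ℝ)
  filter_upwards [hlim, Filter.eventually_gt_atTop 0] with n hn hn0
  simp only [Function.comp, id] at hn
  obtain ⟨w, rfl⟩ : ∃ w, u = w + 1 := ⟨u - 1, by omega⟩
  have : (0 : ℝ) < (n : ℝ) ^ w := by positivity
  calc (K : ℝ) * (n : ℝ) ^ w < (ε * n) * (n : ℝ) ^ w := by gcongr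
    _ = _ := by rw [pow_succ]; ring

/-- Only few `u`-sets have a list with more than `t` elements. -/
theorem eventually_card_long_lists_lt {u t : ℕ} (hu : 2 ≤ u) (ht : 1 ≤ t) (D : ℕ) {ε : ℝ}
    (hε : 0 < ε) : ∀ᶠ n : ℕ in Filter.atTop, ∀ (H : Finset (Finset (Fin n)))
      (L : Finset (Fin n) → Finset (Fin n)), (∀ e ∈ H, e.card = u + 1) →
      ¬ HasPath H (2 * t + 2) → IsListing H u D L →
      (((powersetCard u univ).filter fun f => t + 1 ≤ (L f).card).card : ℝ) <
        ε * (n : ℝ) ^ u := by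
  obtain ⟨β, hβ, hev⟩ := exists_hasPath_of_light hu (2 * t + 2) D (half_pos hε)
  set h := ⌊D / β⌋₊ with hh
  set ε' : ℝ := ε / 2 / 2 ^ h with hε'
  have hε'0 : 0 < ε' := by positivity
  filter_upwards [hev, eventually_flex hu ht (half_pos hε'0) le_rfl,
    eventually_lt_mul_pow (u + 1) (show 1 ≤ u by omega) (half_pos hε'0),
    Filter.eventually_gt_atTop 0] with n h1 h2 h3 hn H L hH hno hL
  by_contra! hlarge
  set G := (powersetCard u univ).filter fun f => t + 1 ≤ (L f).card with hG
  have hGu : ∀ f ∈ G, f.card = u ∧ t + 1 ≤ (L f).card := fun f hf => by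
    rw [hG, mem_filter, mem_powersetCard] at hf
    exact ⟨hf.1.2, hf.2⟩
  set W := heavyVerts G L (β * (n : ℝ) ^ u) with hW
  have hWc : W.card ≤ h := card_heavyVerts_le hβ hn (fun f hf =>
    ⟨(hGu f hf).1, (hL f (hGu f hf).1).1⟩)
  have hpow : (0 : ℝ) < (n : ℝ) ^ u := by positivity
  have hlight : ((G.filter fun f => 2 ≤ (L f \ W).card).card : ℝ) < ε / 2 * (n : ℝ) ^ u := by
    by_contra! hcon
    refine hno (h1 H (G.filter fun f => 2 ≤ (L f \ W).card) (fun f => L f \ W) ?_ ?_ hcon)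
    · intro f hf
      obtain ⟨hfG, hf2⟩ := mem_filter.1 hf
      obtain ⟨h4, h5⟩ := hL f (hGu f hfG).1
      exact ⟨(hGu f hfG).1, (card_le_card sdiff_subset).trans h4, hf2,
        fun c hc => h5 c (mem_sdiff.1 hc).1⟩
    · intro c
      by_cases hc : c ∈ W
      · rw [filter_eq_empty_iff.2 fun f _ h => (mem_sdiff.1 h).2 hc]
        simp only [card_empty, Nat.cast_zero]
        positivity
      · have hc' : ((G.filter fun f => c ∈ L f).card : ℝ) ≤ β * (n : ℝ) ^ u := by
          simpa [hW, heavyVerts] using hc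
        refine le_trans ?_ hc'
        norm_cast
        refine card_le_card fun f hf => ?_
        obtain ⟨hf1, hf2⟩ := mem_filter.1 hf
        exact mem_filter.2 ⟨(mem_filter.1 hf1).1, (mem_sdiff.1 hf2).1⟩
  set G₁ := G.filter fun f => ¬ 2 ≤ (L f \ W).card with hG₁
  have hsum : ((G.filter fun f => 2 ≤ (L f \ W).card).card : ℝ) + G₁.card = G.card := by
    exact_mod_cast card_filter_add_card_filter_not (s := G) _
  have hG₁c : ε / 2 * (n : ℝ) ^ u < G₁.card := by linarith
  have hne : G₁.Nonempty := by
    rw [← card_pos]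
    have : (0 : ℝ) < G₁.card := lt_trans (by positivity) hG₁c
    exact_mod_cast this
  obtain ⟨S, hSt, hS⟩ := exists_popular_subset (L := L) hWc hne (t := t) (fun f hf => by
    obtain ⟨hf1, hf2⟩ := mem_filter.1 hf
    have := card_sdiff_add_card_inter (L f) W
    have := (hGu f hf1).2
    omega)
  set F := G₁.filter fun f => S ⊆ L f with hF
  have hFG : ∀ f ∈ F, f ∈ G ∧ S ⊆ L f := fun f hf => by
    obtain ⟨hf1, hf2⟩ := mem_filter.1 hf
    exact ⟨(mem_filter.1 hf1).1, hf2⟩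
  have hFc : ε' * (n : ℝ) ^ u ≤ F.card := by
    have : ε' * (n : ℝ) ^ u = ε / 2 * (n : ℝ) ^ u / 2 ^ h := by rw [hε']; ring
    rw [this, div_le_iff₀ (by positivity), mul_comm (F.card : ℝ)]
    exact hG₁c.le.trans hS
  have hFsub : F ⊆ commonLink H S u := fun f hf =>
    hL.mem_commonLink (hGu f (hFG f hf).1).1 (hFG f hf).2
  obtain ⟨-, -, -, hout⟩ := h2 H S hH hno hSt
    (hFc.trans (by exact_mod_cast card_le_card hFsub))
  set U := richVerts H S u (ε' / 2) with hU
  have hdis := card_commonLink_disjoint_le hu H S (half_pos hε'0)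
  have hF1 : F.filter (fun f => Disjoint f U) ⊆
      (commonLink H S u).filter fun f => Disjoint f U := filter_subset_filter _ hFsub
  have hF2 : F.filter (fun f => ¬ Disjoint f U) ⊆ outerLink H S U u := by
    intro f hf
    obtain ⟨hfF, hfU⟩ := mem_filter.1 hf
    obtain ⟨hfG, hfS⟩ := hFG f hfF
    obtain ⟨hfu, hft⟩ := hGu f hfG
    obtain ⟨c, hc, hcS⟩ : ∃ c ∈ L f, c ∉ S := by
      by_contra! hcon
      have := card_le_card (show L f ⊆ S from hcon)
      omega
    exact mem_outerLink.2 ⟨hfu, (mem_commonLink.1 (hFsub hfF)).2.1, hfU, c, hcS,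
      (hL f hfu).2 c hc⟩
  have e1 : ((F.filter fun f => Disjoint f U).card : ℝ) ≤ ε' / 2 * (n : ℝ) ^ u :=
    le_trans (by exact_mod_cast card_le_card hF1) hdis
  have e2 : ((F.filter fun f => ¬ Disjoint f U).card : ℝ) ≤
      ((u + 1 : ℕ) : ℝ) * (n : ℝ) ^ (u - 1) := by
    exact_mod_cast (card_le_card hF2).trans hout
  have e3 : ((F.filter fun f => Disjoint f U).card : ℝ) +
      (F.filter fun f => ¬ Disjoint f U).card = F.card := by
    exact_mod_cast card_filter_add_card_filter_not (s := F) _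
  linarith

/-- The values of `F` on consecutive pairs of a list. -/
def consecutive {ι α : Type*} (F : ι → ι → α) : List ι → List α
  | i :: j :: l => F i j :: consecutive F (j :: l)
  | _ => []

lemma length_consecutive {ι α : Type*} (F : ι → ι → α) (l : List ι) :
    (consecutive F l).length = l.length - 1 := by
  induction l with
  | nil => rfl
  | cons i l ih =>
    cases l with
    | nil => rfl
    | cons j l => simp [consecutive, ih]

lemma exists_of_mem_consecutive {ι α : Type*} [LinearOrder ι] {F : ι → ι → α} {l : List ι}
    (hl : l.Pairwise (· < ·)) {e : α} (he : e ∈ consecutive F l) :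
    ∃ a ∈ l, ∃ b ∈ l, a < b ∧ e = F a b := by
  induction l with
  | nil => simp [consecutive] at he
  | cons i l ih =>
    cases l with
    | nil => simp [consecutive] at he
    | cons j l =>
      rcases List.mem_cons.1 he with rfl | he
      · exact ⟨i, by simp, j, by simp, List.rel_of_pairwise_cons hl (by simp), rfl⟩
      · obtain ⟨a, ha, b, hb, h⟩ := ih (List.Pairwise.of_cons hl) he
        exact ⟨a, List.mem_cons_of_mem _ ha, b, List.mem_cons_of_mem _ hb, h⟩

section Ordered

variable {n : ℕ} {ι : Type*} [LinearOrder ι] {f : ι → ι → Finset (Fin n)}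

lemma LPath.consecutive_cons (hd : ∀ i j a b, i < j → j < a → a < b → Disjoint (f i j) (f a b))
    {x y : ι} {l : List ι} (hl : (x :: y :: l).Pairwise (· < ·))
    (hp : LPath (consecutive f (y :: l)))
    (h1 : ∀ z ∈ l, y < z → (f x y ∩ f y z).card = 1) : LPath (consecutive f (x :: y :: l)) := by
  have hl' := List.Pairwise.of_cons hl
  cases l with
  | nil => exact trivial
  | cons z l =>
    have hxy : x < y := List.rel_of_pairwise_cons hl (by simp)
    have hyz : y < z := List.rel_of_pairwise_cons hl' (by simp)
    refine ⟨h1 z (by simp) hyz, fun g hg => ?_, hp⟩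
    obtain ⟨a, ha, b, -, hab, rfl⟩ := exists_of_mem_consecutive (List.Pairwise.of_cons hl') hg
    exact hd x y a b hxy (List.rel_of_pairwise_cons hl' ha) hab

/-- An Erdős–Szekeres type argument: if of two overlapping triples at least one is good, then a
long increasing sequence with only good consecutive triples exists. -/
lemma exists_lpath_consecutive
    (hd : ∀ i j a b, i < j → j < a → a < b → Disjoint (f i j) (f a b))
    (hr : ∀ i j a b, i < j → j < a → a < b →
      (f i j ∩ f j a).card = 1 ∨ (f j a ∩ f a b).card = 1) (q : ℕ) :
    ∀ X : Finset ι, q * q ≤ X.card → ∃ l : List ι, l.length = q ∧ l.Pairwise (· < ·) ∧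
      (∀ i ∈ l, i ∈ X) ∧ LPath (consecutive f l) := by
  induction q with
  | zero => exact fun X _ => ⟨[], rfl, List.Pairwise.nil, by simp, trivial⟩
  | succ q ih =>
    intro X hX
    set P := X.filter fun y => ∃ w ∈ X, ∃ x ∈ X, w < x ∧ x < y ∧ (f w x ∩ f x y).card ≠ 1
      with hP
    rcases le_or_gt (q + 1) (X \ P).card with hlarge | hsmall
    · obtain ⟨Y, hY, hYc⟩ := exists_subset_card_eq hlarge
      have key : ∀ l : List ι, l.Pairwise (· < ·) → (∀ i ∈ l, i ∈ Y) →
          LPath (consecutive f l) := by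
        intro l hl hlY
        induction l with
        | nil => exact trivial
        | cons x l ihl =>
          cases l with
          | nil => exact trivial
          | cons y l =>
            refine LPath.consecutive_cons hd hl
              (ihl (List.Pairwise.of_cons hl) fun i hi => hlY i (List.mem_cons_of_mem _ hi))
              fun z hz hyz => ?_
            have hzY := mem_sdiff.1 (hY (hlY z (by simp [hz])))
            by_contra hne
            exact hzY.2 (mem_filter.2 ⟨hzY.1, x, (mem_sdiff.1 (hY (hlY x (by simp)))).1,
              y, (mem_sdiff.1 (hY (hlY y (by simp)))).1,
              List.rel_of_pairwise_cons hl (by simp), hyz, hne⟩)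
      refine ⟨Y.sort (· ≤ ·), by rw [length_sort, hYc], ?_, fun i hi => ?_, ?_⟩
      · exact (Y.sortedLT_sort).pairwise
      · exact (mem_sdiff.1 (hY ((mem_sort _).1 hi))).1
      · exact key _ (Y.sortedLT_sort).pairwise fun i hi => (mem_sort _).1 hi
    · have hPc : q * q ≤ P.card := by
        have := card_sdiff_add_card_eq_card (show P ⊆ X from filter_subset _ _)
        nlinarith
      obtain ⟨l, hlen, hl, hlP, hp⟩ := ih P hPc
      cases l with
      | nil =>
        obtain ⟨x, hx⟩ : X.Nonempty := by rw [← card_pos]; nlinarith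
        refine ⟨[x], by rw [← hlen]; rfl, by simp, by simpa using hx, trivial⟩
      | cons y l =>
        obtain ⟨hyX, w, hw, x, hx, hwx, hxy, hne⟩ := mem_filter.1 (hlP y (by simp))
        have hl' : (x :: y :: l).Pairwise (· < ·) := by
          refine List.pairwise_cons.2 ⟨fun z hz => ?_, hl⟩
          rcases List.mem_cons.1 hz with rfl | hz
          · exact hxy
          · exact hxy.trans (List.rel_of_pairwise_cons hl hz)
        refine ⟨x :: y :: l, by simpa using hlen, hl', fun i hi => ?_,
          LPath.consecutive_cons hd hl' hp fun z _ hyz => (hr w x y z hwx hxy hyz).resolve_left hne⟩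
        rcases List.mem_cons.1 hi with rfl | hi
        · exact hx
        · exact (mem_filter.1 (hlP i hi)).1

end Ordered

/-- If every `u`-subset `f` of a large set `M` extends by a vertex `φ f` outside `M`, and these
vertices differ for disjoint sets, then there is a long linear path. -/
lemma hasPath_of_coloring {n u q : ℕ} (hu : 2 ≤ u) {H : Finset (Finset (Fin n))}
    {M : Finset (Fin n)} (hM : M.card = (q + 1) * (q + 1) * (u - 1))
    {φ : Finset (Fin n) → Fin n}
    (hφ : ∀ f ⊆ M, f.card = u → φ f ∉ M ∧ insert (φ f) f ∈ H)
    (hd : ∀ f ⊆ M, ∀ f' ⊆ M, f.card = u → f'.card = u → Disjoint f f' → φ f ≠ φ f') :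
    HasPath H q := by
  obtain ⟨w, rfl⟩ : ∃ w, u = w + 2 := ⟨u - 2, by omega⟩
  set T := (q + 1) * (q + 1) with hT
  obtain ⟨g, hg, hgM⟩ : ∃ g : Fin T × Fin (w + 1) → Fin n, Function.Injective g ∧ ∀ p, g p ∈ M := by
    let e : Fin T × Fin (w + 1) ≃ M := finProdFinEquiv.trans
      ((finCongr hM.symm).trans M.equivFin.symm)
    exact ⟨fun p => (e p : Fin n), Subtype.val_injective.comp e.injective, fun p => (e p).2⟩
  set c : Fin T → Fin T → Finset (Fin T × Fin (w + 1)) :=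
    fun i j => insert (j, 0) ({i} ×ˢ univ) with hc
  have hcmem : ∀ i j p, p ∈ c i j ↔ p = (j, 0) ∨ p.1 = i := by
    intro i j p
    simp only [hc, mem_insert, mem_product, mem_singleton, mem_univ, and_true]
  have hcc : ∀ i j, i < j → (c i j).card = w + 2 := by
    intro i j hij
    rw [hc, card_insert_of_notMem (by simpa using hij.ne), card_product]
    simp
  have hcd : ∀ i j a b, i < j → j < a → a < b → Disjoint (c i j) (c a b) := by
    intro i j a b hij hja hab
    rw [disjoint_left]
    intro p hp hp'
    rw [hcmem] at hp hp'
    rcases hp with rfl | h1 <;> rcases hp' with h2 | h2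
    · have := (Prod.ext_iff.1 h2).1; simp only at this; omega
    · simp only at h2; omega
    · have := (Prod.ext_iff.1 h2).1; simp only at this; omega
    · omega
  have hci : ∀ i j a, i < j → j < a → c i j ∩ c j a = {(j, 0)} := by
    intro i j a hij hja
    ext p
    rw [mem_inter, hcmem, hcmem, mem_singleton]
    constructor
    · rintro ⟨h1 | h1, h2⟩
      · exact h1
      · rcases h2 with h2 | h2
        · have := (Prod.ext_iff.1 h2).1; simp only at this; omega
        · omega
    · rintro rfl
      simp
  set f : Fin T → Fin T → Finset (Fin n) := fun i j => (c i j).image g with hf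
  have hfM : ∀ i j, f i j ⊆ M := fun i j => image_subset_iff.2 fun p _ => hgM p
  have hfc : ∀ i j, i < j → (f i j).card = w + 2 := fun i j hij => by
    rw [hf, card_image_of_injective _ hg, hcc i j hij]
  have hfd : ∀ i j a b, i < j → j < a → a < b → Disjoint (f i j) (f a b) :=
    fun i j a b h1 h2 h3 => (disjoint_image hg).2 (hcd i j a b h1 h2 h3)
  have hφf : ∀ i j, i < j → ∀ i' j', φ (f i j) ∉ f i' j' := fun i j hij i' j' h =>
    (hφ _ (hfM i j) (hfc i j hij)).1 (hfM i' j' h)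
  have hne : ∀ i j a b, i < j → j < a → a < b → φ (f i j) ≠ φ (f a b) :=
    fun i j a b h1 h2 h3 => hd _ (hfM i j) _ (hfM a b) (hfc i j h1) (hfc a b h3)
      (hfd i j a b h1 h2 h3)
  have hone : ∀ i j a, i < j → j < a → φ (f i j) ≠ φ (f j a) →
      (insert (φ (f i j)) (f i j) ∩ insert (φ (f j a)) (f j a)).card = 1 := by
    intro i j a hij hja hn
    rw [insert_inter_of_notMem, inter_insert_of_notMem (hφf j a hja i j), hf, ← image_inter _ _ hg,
      hci i j a hij hja]
    · simp
    · rw [mem_insert, not_or]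
      exact ⟨hn, hφf i j hij j a⟩
  obtain ⟨l, hlen, hl, -, hp⟩ := exists_lpath_consecutive
    (f := fun i j => insert (φ (f i j)) (f i j)) (fun i j a b h1 h2 h3 => by
      rw [disjoint_insert_left, disjoint_insert_right, mem_insert, not_or]
      exact ⟨⟨hne i j a b h1 h2 h3, hφf i j h1 a b⟩, hφf a b h3 i j, hfd i j a b h1 h2 h3⟩)
    (fun i j a b h1 h2 h3 => by
      by_cases h : φ (f i j) = φ (f j a)
      · right
        exact hone j a b h2 h3 (h ▸ hne i j a b h1 h2 h3)
      · exact Or.inl (hone i j a h1 h2 h)) (q + 1) univ (by simp [hT])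
  refine ⟨_, hp, by rw [length_consecutive, hlen]; rfl, fun e he => ?_⟩
  obtain ⟨a, -, b, -, hab, rfl⟩ := exists_of_mem_consecutive hl he
  exact (hφ _ (hfM a b) (hfc a b hab)).2

/-- If almost all `u`-sets have a list of size at least `t`, then the lists of a positive
proportion of them share `t` common elements. -/
theorem exists_common_sublist {u t : ℕ} (hu : 2 ≤ u) {q : ℕ} (hq : 1 ≤ q) (D : ℕ) :
    ∃ ε₀ ε₂ : ℝ, 0 < ε₀ ∧ 0 < ε₂ ∧ ∀ᶠ n : ℕ in Filter.atTop, ∀ (H : Finset (Finset (Fin n)))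
      (L : Finset (Fin n) → Finset (Fin n)), ¬ HasPath H q → IsListing H u D L →
      (((powersetCard u univ).filter fun f => (L f).card < t).card : ℝ) ≤ ε₀ * (n : ℝ) ^ u →
      ∃ S : Finset (Fin n), S.card = t ∧
        ε₂ * (n : ℝ) ^ u ≤ ((powersetCard u univ).filter fun f => S ⊆ L f).card := by
  set m := (q + 1) * (q + 1) * (u - 1) with hm
  obtain ⟨β, hβ, hev⟩ := exists_sample u 1 m
  obtain ⟨γ, hγ, hγe⟩ := exists_le_choose u
  have hum : u ≤ m := by
    have : 4 * (u - 1) ≤ m := Nat.mul_le_mul_right _ (by nlinarith)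
    omega
  set R : ℝ := (m.choose u : ℝ) with hR
  have hR1 : 1 ≤ R := by
    rw [hR]
    exact_mod_cast Nat.choose_pos hum
  set h := ⌊D / β⌋₊ with hh
  set ε₀ : ℝ := γ / (8 * R) with hε₀
  have hε₀0 : 0 < ε₀ := by positivity
  refine ⟨ε₀, ε₀ / 2 ^ h, hε₀0, by positivity, ?_⟩
  filter_upwards [hev, hγe, Filter.eventually_gt_atTop 0, Filter.eventually_ge_atTop u] with
    n h1 h2 hn hun H L hno hL hshort
  have hpow : (0 : ℝ) < (n : ℝ) ^ u := by positivity
  set A := (powersetCard u (univ : Finset (Fin n))).filter fun f => (L f).card < t with hA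
  have hGu : ∀ f ∈ powersetCard u (univ : Finset (Fin n)), f.card = u :=
    fun f hf => (mem_powersetCard.1 hf).2
  set W := heavyVerts (powersetCard u univ) L (β * (n : ℝ) ^ u) with hW
  have hWc : W.card ≤ h := card_heavyVerts_le hβ hn
    (fun f hf => ⟨hGu f hf, (hL f (hGu f hf)).1⟩)
  set B := (powersetCard u (univ : Finset (Fin n))).filter fun f => t ≤ (L f ∩ W).card with hB
  rcases le_or_gt (ε₀ * (n : ℝ) ^ u) B.card with hBl | hBs
  · have hne : B.Nonempty := by
      rw [← card_pos]
      have : (0 : ℝ) < B.card := lt_of_lt_of_le (by positivity) hBl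
      exact_mod_cast this
    obtain ⟨S, hS, hle⟩ := exists_popular_subset (L := L) hWc hne
      (fun f hf => (mem_filter.1 hf).2)
    refine ⟨S, hS, ?_⟩
    have h3 : (B.filter fun f => S ⊆ L f).card ≤
        ((powersetCard u univ).filter fun f => S ⊆ L f).card :=
      card_le_card (filter_subset_filter _ (filter_subset _ _))
    have h4 : ((B.filter fun f => S ⊆ L f).card : ℝ) ≤
        ((powersetCard u univ).filter fun f => S ⊆ L f).card := by exact_mod_cast h3
    have : ε₀ / 2 ^ h * (n : ℝ) ^ u = ε₀ * (n : ℝ) ^ u / 2 ^ h := by ring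
    rw [this, div_le_iff₀ (by positivity), mul_comm (Nat.cast _)]
    refine hBl.trans (hle.trans ?_)
    gcongr
  exfalso
  set G := (powersetCard u (univ : Finset (Fin n))).filter fun f => ∃ c, c ∈ L f \ W with hG
  have hφ : ∀ f, ∃ c, f ∈ G → c ∈ L f \ W := fun f => by
    by_cases hf : f ∈ G
    · obtain ⟨c, hc⟩ := (mem_filter.1 hf).2
      exact ⟨c, fun _ => hc⟩
    · exact ⟨⟨0, hn⟩, fun h => absurd h hf⟩
  choose φ hφ using hφ
  have hGu' : ∀ f ∈ G, f.card = u := fun f hf => hGu f (mem_filter.1 hf).1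
  have hφL : ∀ f ∈ G, φ f ∉ f ∧ insert (φ f) f ∈ H := fun f hf =>
    (hL f (hGu' f hf)).2 _ (mem_sdiff.1 (hφ f hf)).1
  have hcov : powersetCard u univ ⊆ G ∪ (A ∪ B) := by
    intro f hf
    rw [mem_union, mem_union]
    by_cases h3 : f ∈ G
    · exact Or.inl h3
    by_cases h4 : (L f).card < t
    · exact Or.inr (Or.inl (mem_filter.2 ⟨hf, h4⟩))
    · refine Or.inr (Or.inr (mem_filter.2 ⟨hf, ?_⟩))
      have h5 : L f ⊆ W := by
        intro c hc
        by_contra hcW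
        exact h3 (mem_filter.2 ⟨hf, c, mem_sdiff.2 ⟨hc, hcW⟩⟩)
      rw [inter_eq_left.2 h5]
      omega
  have hN : (0 : ℝ) < n.choose u := by exact_mod_cast Nat.choose_pos hun
  have hcard : (n.choose u : ℝ) ≤ G.card + 2 * (ε₀ * (n : ℝ) ^ u) := by
    have h3 := (card_le_card hcov).trans (card_union_le _ _)
    have h4 := card_union_le A B
    rw [card_powersetCard, card_univ, Fintype.card_fin] at h3
    have h5 : (n.choose u : ℝ) ≤ G.card + (A.card + B.card) := by exact_mod_cast (by omega)
    linarith
  have hratio : R - 1 / 4 ≤ R * G.card / n.choose u := by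
    rw [le_div_iff₀ hN]
    have h3 : R * (2 * (ε₀ * (n : ℝ) ^ u)) = 1 / 4 * (γ * (n : ℝ) ^ u) := by
      rw [hε₀]; field_simp; ring
    have h4 := mul_le_mul_of_nonneg_left hcard (by linarith : 0 ≤ R)
    rw [mul_add, h3] at h4
    linarith
  obtain ⟨M, hM, hGM, hLM, hLL⟩ := h1 G (fun f => {φ f}) (fun f hf =>
    ⟨hGu' f hf, by simp, by simpa using (hφL f hf).1⟩) (fun c => by
      by_cases hc : c ∈ W
      · rw [filter_eq_empty_iff.2 fun f hf h => (mem_sdiff.1 (hφ f hf)).2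
          (by rw [mem_singleton] at h; exact h ▸ hc)]
        simp only [card_empty, Nat.cast_zero]
        positivity
      · have hc' : (((powersetCard u univ).filter fun f => c ∈ L f).card : ℝ) ≤
            β * (n : ℝ) ^ u := by
          simpa [hW, heavyVerts] using hc
        refine le_trans ?_ hc'
        norm_cast
        refine card_le_card fun f hf => ?_
        obtain ⟨hf1, hf2⟩ := mem_filter.1 hf
        rw [mem_singleton] at hf2
        exact mem_filter.2 ⟨(mem_filter.1 hf1).1, hf2 ▸ (mem_sdiff.1 (hφ f hf1)).1⟩)
    (by linarith)
  have hall : ∀ f ⊆ M, f.card = u → f ∈ G := by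
    intro f hf hfu
    by_contra hfG
    have h3 : (G.filter fun f => f ⊆ M).card < (powersetCard u M).card := by
      refine card_lt_card ⟨fun g hg => ?_, fun hsub => ?_⟩
      · exact mem_powersetCard.2 ⟨(mem_filter.1 hg).2, hGu' g (mem_filter.1 hg).1⟩
      · exact hfG (mem_filter.1 (hsub (mem_powersetCard.2 ⟨hf, hfu⟩))).1
    rw [card_powersetCard, hM] at h3
    have h4 : ((G.filter fun f => f ⊆ M).card : ℝ) + 1 ≤ R := by
      rw [hR]
      exact_mod_cast h3
    linarith
  refine hno (hasPath_of_coloring hu hM (φ := φ) (fun f hf hfu => ⟨?_, (hφL f (hall f hf hfu)).2⟩)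
    fun f hf f' hf' hfu hfu' hd => ?_)
  · simpa using hLM f (hall f hf hfu) hf
  · have := hLL f (hall f hf hfu) f' (hall f' hf' hfu') hf hf' hd
    simpa [eq_comm] using this

/-- A hypergraph without long paths is encoded by short lists of extensions of `u`-sets. -/
theorem exists_isListing {n u q : ℕ} (hu : 2 ≤ u) (H : Finset (Finset (Fin n)))
    (hH : ∀ e ∈ H, e.card = u + 1) (hno : ¬ HasPath H q) :
    ∃ L, IsListing H u (q * (u + 1)) L ∧ ∑ f ∈ powersetCard u univ, (L f).card = H.card := by
  obtain ⟨a, ha, hfib⟩ := exists_shadow_assignment (by omega) H hH hno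
  have hcard : ∀ f : Finset (Fin n), f.card = u →
      (univ.filter fun c => c ∉ f ∧ insert c f ∈ H ∧ a (insert c f) = f).card =
        (H.filter fun e => a e = f).card := by
    intro f hf
    refine card_bij (fun c _ => insert c f) ?_ ?_ ?_
    · intro c hc
      exact mem_filter.2 (mem_filter.1 hc).2.2
    · intro c hc d hd h
      have : c ∈ insert d f := h ▸ mem_insert_self c f
      exact (mem_insert.1 this).resolve_right (mem_filter.1 hc).2.1
    · intro e he
      obtain ⟨heH, hae⟩ := mem_filter.1 he
      obtain ⟨c, -, hcf, rfl⟩ := exists_insert_of_subset (hH e heH) hf (hae ▸ (ha e heH).1)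
      exact ⟨c, mem_filter.2 ⟨mem_univ _, hcf, heH, hae⟩, rfl⟩
  refine ⟨fun f => univ.filter fun c => c ∉ f ∧ insert c f ∈ H ∧ a (insert c f) = f,
    fun f hf => ⟨(hcard f hf).trans_le (hfib f), fun c hc => ?_⟩, ?_⟩
  · exact ⟨(mem_filter.1 hc).2.1, (mem_filter.1 hc).2.2.1⟩
  · rw [card_eq_sum_card_fiberwise (f := a) (t := powersetCard u univ) fun e he =>
      mem_powersetCard.2 ⟨subset_univ _, by have := (ha e he).2; omega⟩]
    exact sum_congr rfl fun f hf => hcard f (mem_powersetCard.1 hf).2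

lemma choose_le_choose_sub_add {n u : ℕ} (hu : 1 ≤ u) (i : ℕ) :
    n.choose u ≤ (n - i).choose u + i * n ^ (u - 1) := by
  obtain ⟨w, rfl⟩ : ∃ w, u = w + 1 := ⟨u - 1, by omega⟩
  induction i with
  | zero => simp
  | succ i ih =>
    refine ih.trans ?_
    rw [Nat.add_sub_cancel, add_mul, one_mul]
    rcases Nat.eq_zero_or_pos (n - i) with h | h
    · rw [h, show n - (i + 1) = 0 by omega]
      omega
    · obtain ⟨m, hm⟩ : ∃ m, n - i = m + 1 := ⟨n - i - 1, by omega⟩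
      rw [hm, show n - (i + 1) = m by omega, Nat.choose_succ_succ']
      have := (Nat.choose_le_pow m w).trans (Nat.pow_le_pow_left (show m ≤ n by omega) w)
      omega

lemma mul_choose_le_sum_choose {n u : ℕ} (hu : 1 ≤ u) (t : ℕ) :
    t * n.choose u ≤ ∑ i ∈ Icc 1 t, (n - i).choose u + t * t * n ^ (u - 1) := by
  have : ∑ i ∈ Icc 1 t, n.choose u ≤ ∑ i ∈ Icc 1 t, ((n - i).choose u + t * n ^ (u - 1)) :=
    sum_le_sum fun i hi => (choose_le_choose_sub_add hu i).trans <| by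
      gcongr
      exact (mem_Icc.1 hi).2
  simpa [sum_add_distrib, mul_assoc] using this

lemma sum_card_add_card_short_le {n u D t : ℕ} {H : Finset (Finset (Fin n))}
    {L : Finset (Fin n) → Finset (Fin n)} (hL : IsListing H u D L) :
    ∑ f ∈ powersetCard u univ, (L f).card +
        ((powersetCard u univ).filter fun f => (L f).card < t).card ≤
      t * n.choose u + D * ((powersetCard u univ).filter fun f => t + 1 ≤ (L f).card).card := by
  have hc : n.choose u = (powersetCard u (univ : Finset (Fin n))).card := by simp
  rw [card_filter, card_filter, mul_sum, ← sum_add_distrib, hc, mul_comm t, ← smul_eq_mul,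
    ← sum_const, ← sum_add_distrib]
  refine sum_le_sum fun f hf => ?_
  have := (hL f (mem_powersetCard.1 hf).2).1
  split_ifs <;> omega

lemma sum_card_filter_mem_le {n u : ℕ} (W : Finset (Fin n)) {Y : Finset (Finset (Fin n))}
    (hY : ∀ f ∈ Y, f.card = u) : ∑ w ∈ W, (Y.filter fun f => w ∈ f).card ≤ u * Y.card := by
  have h := sum_card_bipartiteAbove_eq_sum_card_bipartiteBelow (s := W) (t := Y)
    (fun w f => w ∈ f)
  simp only [bipartiteAbove, bipartiteBelow] at h
  rw [h, mul_comm, ← smul_eq_mul, ← sum_const]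
  refine sum_le_sum fun f hf => ?_
  rw [← hY f hf]
  exact card_le_card fun w hw => (mem_filter.1 hw).2

lemma card_mul_le_of_not_rich {n u : ℕ} {H : Finset (Finset (Fin n))} {S W : Finset (Fin n)}
    {η : ℝ} (hW : Disjoint W (richVerts H S u η)) {Y : Finset (Finset (Fin n))}
    (hY : ∀ f ∈ Y, f.card = u)
    (hX : ∀ w ∈ W, ∃ X : Finset (Finset (Fin n)), 2 * η * (n : ℝ) ^ (u - 1) ≤ X.card ∧
      ∀ f ∈ X, w ∈ f ∧ (f ∈ commonLink H S u ∨ f ∈ Y)) :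
    W.card * (η * (n : ℝ) ^ (u - 1)) ≤ u * Y.card := by
  have h : ∀ w ∈ W, η * (n : ℝ) ^ (u - 1) ≤ (Y.filter fun f => w ∈ f).card := by
    intro w hw
    obtain ⟨X, hX1, hX2⟩ := hX w hw
    have h1 : ¬ η * (n : ℝ) ^ (u - 1) ≤ ((commonLink H S u).filter (w ∈ ·)).card := by
      intro h
      exact disjoint_left.1 hW hw (mem_filter.2 ⟨mem_univ _, h⟩)
    have h2 : (X.card : ℝ) ≤ ((commonLink H S u).filter (w ∈ ·)).card +
        (Y.filter fun f => w ∈ f).card := by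
      norm_cast
      refine (card_le_card fun f hf => ?_).trans (card_union_le _ _)
      obtain ⟨h3, h4⟩ := hX2 f hf
      rw [mem_union, mem_filter, mem_filter]
      tauto
    linarith
  calc (W.card : ℝ) * (η * (n : ℝ) ^ (u - 1))
      = ∑ w ∈ W, η * (n : ℝ) ^ (u - 1) := by rw [sum_const, nsmul_eq_mul]
    _ ≤ ∑ w ∈ W, ((Y.filter fun f => w ∈ f).card : ℝ) := sum_le_sum h
    _ ≤ u * Y.card := by exact_mod_cast sum_card_filter_mem_le W hY

lemma exists_family_through {n u : ℕ} (hu : 1 ≤ u) {V : Finset (Fin n)} {w : Fin n}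
    (hw : w ∉ V) : ∃ X : Finset (Finset (Fin n)), X.card = V.card.choose (u - 1) ∧
      ∀ f ∈ X, w ∈ f ∧ f.card = u ∧ f ⊆ insert w V ∧ (2 ≤ u → ¬ Disjoint f V) := by
  refine ⟨(powersetCard (u - 1) V).image (insert w), ?_, fun f hf => ?_⟩
  · rw [card_image_of_injOn, card_powersetCard]
    intro g hg g' hg' h
    have hg := mt (@(mem_powersetCard.1 hg).1 w) hw
    have hg' := mt (@(mem_powersetCard.1 hg').1 w) hw
    rw [← erase_insert hg, ← erase_insert hg']
    exact congrArg (fun s => erase s w) h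
  · obtain ⟨g, hg, rfl⟩ := mem_image.1 hf
    obtain ⟨hgV, hgc⟩ := mem_powersetCard.1 hg
    refine ⟨mem_insert_self _ _, ?_, insert_subset_insert _ hgV, fun h2 => ?_⟩
    · rw [card_insert_of_notMem fun h => hw (hgV h)]
      omega
    · obtain ⟨x, hx⟩ := card_pos.1 (show 0 < g.card by omega)
      exact not_disjoint_iff.2 ⟨x, mem_insert_of_mem hx, hgV hx⟩

/-- The `u`-sets disjoint from `S` that fail to extend by some vertex of `S`. -/
def missedSets {n : ℕ} (H : Finset (Finset (Fin n))) (S : Finset (Fin n)) (u : ℕ) :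
    Finset (Finset (Fin n)) :=
  (powersetCard u univ).filter fun f => Disjoint f S ∧ f ∉ commonLink H S u

lemma exists_choose_bound (a : ℕ) {ε : ℝ} (hε : 0 < ε) : ∃ γ : ℝ, 0 < γ ∧
    ∀ᶠ n : ℕ in Filter.atTop, ∀ m : ℕ, ε * n ≤ m → γ * (n : ℝ) ^ a ≤ m.choose a := by
  obtain ⟨γ, hγ, h⟩ := exists_le_choose a
  obtain ⟨m₀, hm₀⟩ := Filter.eventually_atTop.1 h
  refine ⟨γ * ε ^ a, by positivity, ?_⟩
  have h1 := ((Filter.tendsto_id.const_mul_atTop hε).comp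
    tendsto_natCast_atTop_atTop).eventually_ge_atTop (m₀ : ℝ)
  filter_upwards [h1] with n hn m hm
  simp only [Function.comp, id] at hn
  refine le_trans ?_ (hm₀ m (by exact_mod_cast hn.trans hm))
  rw [mul_assoc, ← mul_pow]
  gcongr

/-- Stability: an almost extremal hypergraph has a `t`-set `S` and a set `U` of almost all
vertices along which paths are easily extended; moreover the number of missing edges is controlled
from below by the number of the remaining vertices. -/
theorem eventually_exists_core {u t : ℕ} (hu : 2 ≤ u) (ht : 1 ≤ t) : ∃ η : ℝ, 0 < η ∧
    ∀ ε : ℝ, 0 < ε → ∀ᶠ n : ℕ in Filter.atTop, ∀ H : Finset (Finset (Fin n)),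
      (∀ e ∈ H, e.card = u + 1) → ¬ HasPath H (2 * t + 2) →
      ∑ i ∈ Icc 1 t, (n - i).choose u ≤ H.card →
      ∃ S U : Finset (Fin n), S.card = t ∧ Disjoint U S ∧ Flex H S u (avoidBound u t) U ∧
        avoidBound u t < U.card ∧ ((univ \ (U ∪ S)).card : ℝ) ≤ ε * n ∧
        (univ \ (U ∪ S)).card * (η * (n : ℝ) ^ (u - 1)) ≤ u * (missedSets H S u).card := by
  set D := (2 * t + 2) * (u + 1) with hD
  obtain ⟨ε₀, ε₂, hε₀, hε₂, hB⟩ := exists_common_sublist (t := t) hu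
    (show 1 ≤ 2 * t + 2 by omega) D
  obtain ⟨γ₁, hγ₁, hc₁⟩ := exists_choose_bound (u - 1) (half_pos hε₂)
  obtain ⟨γ₂, hγ₂, hc₂⟩ := exists_choose_bound (u - 1) (show (0 : ℝ) < 1 / 2 by norm_num)
  set η := min (ε₂ / 2) (min (γ₁ / 2) (γ₂ / 2)) with hη
  have hη0 : 0 < η := by positivity
  have hη1 : η ≤ ε₂ / 2 := min_le_left _ _
  have hη2 : 2 * η ≤ γ₁ := by
    have : η ≤ γ₁ / 2 := (min_le_right _ _).trans (min_le_left _ _)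
    linarith
  have hη3 : 2 * η ≤ γ₂ := by
    have : η ≤ γ₂ / 2 := (min_le_right _ _).trans (min_le_right _ _)
    linarith
  refine ⟨η, hη0, fun ε hε => ?_⟩
  set ε₃ := min ε₀ (η * ε / (2 * u)) with hε₃
  have hu0 : (0 : ℝ) < u := by exact_mod_cast (show 0 < u by omega)
  have hε₃0 : 0 < ε₃ := by positivity
  have hDpos : (0 : ℝ) < D := by exact_mod_cast (show 0 < D by positivity)
  have hA := eventually_card_long_lists_lt hu ht D (ε := ε₃ / (2 * D)) (by positivity)
  filter_upwards [hA, hB, eventually_flex hu ht hη0 hη1, hc₁, hc₂,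
    eventually_lt_mul_pow (t * t) (u := u) (by omega) (half_pos hε₃0),
    eventually_lt_mul_pow (u * (u + 1)) (u := u) (by omega)
      (show 0 < η * ε / 2 by positivity),
    Filter.eventually_ge_atTop (2 * (t + 1))] with n hA hB hfl hc₁ hc₂ hp₁ hp₂ hn H hH hno hcard
  obtain ⟨L, hL, hsum⟩ := exists_isListing hu H hH hno
  have hA := hA H L hH hno hL
  have hshort : (((powersetCard u univ).filter fun f => (L f).card < t).card : ℝ) ≤
      ε₃ * (n : ℝ) ^ u := by
    have h1 := sum_card_add_card_short_le (t := t) hL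
    have h2 := mul_choose_le_sum_choose (n := n) (u := u) (by omega) t
    have h3 : ((powersetCard u univ).filter fun f => (L f).card < t).card ≤
        t * t * n ^ (u - 1) +
          D * ((powersetCard u univ).filter fun f => t + 1 ≤ (L f).card).card := by
      rw [hsum, ← hD] at h1
      omega
    have h4 : (((powersetCard u univ).filter fun f => (L f).card < t).card : ℝ) ≤
        ((t * t : ℕ) : ℝ) * (n : ℝ) ^ (u - 1) +
          D * ((powersetCard u univ).filter fun f => t + 1 ≤ (L f).card).card := by
      exact_mod_cast h3
    have h5 := mul_le_mul_of_nonneg_left hA.le hDpos.le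
    have h6 : (D : ℝ) * (ε₃ / (2 * D) * (n : ℝ) ^ u) = ε₃ / 2 * (n : ℝ) ^ u := by
      field_simp
    linarith
  obtain ⟨S, hS, hSc⟩ := hB H L hno hL (hshort.trans (by gcongr; exact min_le_left _ _))
  have hcl : ε₂ * (n : ℝ) ^ u ≤ (commonLink H S u).card := hSc.trans <| by
    norm_cast
    refine card_le_card fun f hf => ?_
    obtain ⟨hf1, hf2⟩ := mem_filter.1 hf
    exact hL.mem_commonLink (mem_powersetCard.1 hf1).2 hf2
  obtain ⟨hflex, hU, hUn, hout⟩ := hfl H S hH hno hS hcl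
  have hUS := disjoint_richVerts (H := H) (S := S) (u := u) hη0
  set U := richVerts H S u η with hUdef
  have hWU : Disjoint (univ \ (U ∪ S)) U :=
    disjoint_left.2 fun w hw hwU => (mem_sdiff.1 hw).2 (mem_union_left _ hwU)
  have hWS : ∀ w ∈ univ \ (U ∪ S), w ∉ U ∧ w ∉ S := fun w hw => by
    simpa [not_or] using hw
  refine ⟨S, U, hS, hUS, hflex, hU, ?_, ?_⟩
  · set Y := (powersetCard u univ).filter fun f =>
      f ∈ outerLink H S U u ∨ (L f).card < t with hY
    have h1 := card_mul_le_of_not_rich hWU (Y := Y)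
      (fun f hf => (mem_powersetCard.1 (mem_filter.1 hf).1).2) fun w hw => by
        obtain ⟨X, hX1, hX2⟩ := exists_family_through (u := u) (by omega) (hWS w hw).1
        refine ⟨X, ?_, fun f hf => ?_⟩
        · rw [hX1]
          exact le_trans (by gcongr) (hc₁ _ hUn)
        · obtain ⟨hwf, hfu, hfU, hfd⟩ := hX2 f hf
          have hfd := hfd hu
          have hfS : Disjoint f S := disjoint_left.2 fun x hx hxS => by
            rcases mem_insert.1 (hfU hx) with rfl | h
            · exact (hWS x hw).2 hxS
            · exact disjoint_left.1 hUS h hxS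
          refine ⟨hwf, ?_⟩
          by_contra! hcon
          obtain ⟨hcl, hfY⟩ := hcon
          rw [hY, mem_filter, mem_powersetCard] at hfY
          push Not at hfY
          obtain ⟨hfo, hft⟩ := hfY ⟨subset_univ _, hfu⟩
          have hsub : L f ⊆ S := fun c hc => by
            by_contra hcS
            exact hfo (mem_outerLink.2 ⟨hfu, hfS, hfd, c, hcS, (hL f hfu).2 c hc⟩)
          exact hcl (hL.mem_commonLink hfu (eq_of_subset_of_card_le hsub (by omega)).ge)
    have h2 : (Y.card : ℝ) ≤ (u + 1 : ℕ) * (n : ℝ) ^ (u - 1) + ε₃ * (n : ℝ) ^ u := by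
      have : Y.card ≤ (outerLink H S U u).card +
          ((powersetCard u univ).filter fun f => (L f).card < t).card := by
        refine (card_le_card fun f hf => ?_).trans (card_union_le _ _)
        obtain ⟨h3, h4⟩ := mem_filter.1 hf
        exact mem_union.2 (h4.imp id fun h => mem_filter.2 ⟨h3, h⟩)
      calc (Y.card : ℝ) ≤ (outerLink H S U u).card +
          ((powersetCard u univ).filter fun f => (L f).card < t).card := by exact_mod_cast this
        _ ≤ _ := add_le_add (by exact_mod_cast hout) hshort
    have h3 : (u : ℝ) * (ε₃ * (n : ℝ) ^ u) ≤ η * ε / 2 * (n : ℝ) ^ u := by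
      have : ε₃ ≤ η * ε / (2 * u) := min_le_right _ _
      calc (u : ℝ) * (ε₃ * (n : ℝ) ^ u) ≤ u * (η * ε / (2 * u) * (n : ℝ) ^ u) := by gcongr
        _ = _ := by field_simp
    have h4 : ((univ \ (U ∪ S)).card : ℝ) * (η * (n : ℝ) ^ (u - 1)) ≤ η * ε * (n : ℝ) ^ u := by
      have h5 := mul_le_mul_of_nonneg_left h2 hu0.le
      push_cast at h5 hp₂
      linarith
    have hpos : 0 < η * (n : ℝ) ^ (u - 1) := by
      have : (0 : ℝ) < n := by exact_mod_cast (show 0 < n by omega)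
      positivity
    refine le_of_mul_le_mul_right (h4.trans_eq ?_) hpos
    obtain ⟨w, rfl⟩ : ∃ w, u = w + 1 := ⟨u - 1, by omega⟩
    rw [Nat.add_sub_cancel, pow_succ]
    ring
  · refine card_mul_le_of_not_rich hWU
      (fun f hf => (mem_powersetCard.1 (mem_filter.1 hf).1).2) fun w hw => ?_
    obtain ⟨X, hX1, hX2⟩ := exists_family_through (u := u) (by omega)
      (V := univ \ insert w S) (w := w) (by simp)
    have hV : (univ \ insert w S).card = n - (t + 1) := by
      rw [card_sdiff_of_subset (subset_univ _), card_insert_of_notMem (hWS w hw).2, hS, card_univ,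
        Fintype.card_fin]
    refine ⟨X, ?_, fun f hf => ?_⟩
    · rw [hX1, hV]
      refine le_trans (by gcongr) (hc₂ _ ?_)
      rw [Nat.cast_sub (by omega)]
      have : ((2 * (t + 1) : ℕ) : ℝ) ≤ n := by exact_mod_cast hn
      push_cast at this ⊢
      linarith
    · obtain ⟨hwf, hfu, hfU, -⟩ := hX2 f hf
      have hfS : Disjoint f S := disjoint_left.2 fun x hx hxS => by
        rcases mem_insert.1 (hfU hx) with rfl | h
        · exact (hWS x hw).2 hxS
        · exact (mem_sdiff.1 h).2 (mem_insert_of_mem hxS)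
      refine ⟨hwf, ?_⟩
      by_cases h : f ∈ commonLink H S u
      · exact Or.inl h
      · exact Or.inr (mem_filter.2 ⟨mem_powersetCard.2 ⟨subset_univ _, hfu⟩, hfS, h⟩)

lemma sum_choose_add_choose (u : ℕ) {n t : ℕ} (ht : t ≤ n) :
    ∑ i ∈ Icc 1 t, (n - i).choose u + (n - t).choose (u + 1) = n.choose (u + 1) := by
  induction t with
  | zero => simp
  | succ t ih =>
    rw [← ih (by omega), sum_Icc_succ_top (by omega)]
    obtain ⟨m, hm⟩ : ∃ m, n - t = m + 1 := ⟨n - t - 1, by omega⟩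
    rw [hm, show n - (t + 1) = m by omega, Nat.choose_succ_succ' m u]
    omega

lemma card_filter_meets (u : ℕ) {n t : ℕ} {S : Finset (Fin n)} (hS : S.card = t) :
    ((powersetCard (u + 1) univ).filter fun e => ¬ Disjoint e S).card =
      ∑ i ∈ Icc 1 t, (n - i).choose u := by
  have ht : t ≤ n := by simpa [hS] using card_le_univ S
  have h1 := card_filter_add_card_filter_not (s := powersetCard (u + 1) (univ : Finset (Fin n)))
    (fun e => Disjoint e S)
  have h2 : ((powersetCard (u + 1) (univ : Finset (Fin n))).filter fun e => Disjoint e S) =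
      powersetCard (u + 1) (univ \ S) := by
    ext e
    simp only [mem_filter, mem_powersetCard, subset_univ, true_and, subset_sdiff]
    exact and_comm
  rw [h2, card_powersetCard, card_powersetCard, card_sdiff_of_subset (subset_univ _), card_univ,
    Fintype.card_fin, hS, ← sum_choose_add_choose u ht] at h1
  omega

lemma card_filter_meets_add_card_missedSets_le {n u : ℕ} {H : Finset (Finset (Fin n))}
    {S : Finset (Fin n)} (hH : ∀ e ∈ H, e.card = u + 1) :
    (H.filter fun e => ¬ Disjoint e S).card + (missedSets H S u).card ≤
      ((powersetCard (u + 1) univ).filter fun e => ¬ Disjoint e S).card := by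
  have h : ∀ f ∈ missedSets H S u,
      ∃ e, e ∉ H ∧ e.card = u + 1 ∧ ¬ Disjoint e S ∧ e \ S = f := by
    intro f hf
    obtain ⟨hfu, hfS, hfc⟩ := mem_filter.1 hf
    obtain ⟨c, hcS, hcH⟩ : ∃ c ∈ S, insert c f ∉ H := by
      by_contra! hcon
      exact hfc (mem_commonLink.2 ⟨(mem_powersetCard.1 hfu).2, hfS, hcon⟩)
    refine ⟨insert c f, hcH, ?_, not_disjoint_iff.2 ⟨c, mem_insert_self _ _, hcS⟩, ?_⟩
    · rw [card_insert_of_notMem fun h => disjoint_left.1 hfS h hcS, (mem_powersetCard.1 hfu).2]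
    · rw [insert_sdiff_of_mem _ hcS, sdiff_eq_self_of_disjoint hfS]
  choose! g hgH hgu hgS hg using h
  rw [← card_image_of_injOn (s := missedSets H S u) (f := g) fun f hf f' hf' h => by
      rw [← hg f hf, ← hg f' hf', h], ← card_union_of_disjoint]
  · refine card_le_card fun e he => ?_
    rw [mem_filter, mem_powersetCard]
    rcases mem_union.1 he with he | he
    · obtain ⟨heH, heS⟩ := mem_filter.1 he
      exact ⟨⟨subset_univ _, hH e heH⟩, heS⟩
    · obtain ⟨f, hf, rfl⟩ := mem_image.1 he
      exact ⟨⟨subset_univ _, hgu f hf⟩, hgS f hf⟩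
  · refine disjoint_left.2 fun e he he' => ?_
    obtain ⟨f, hf, rfl⟩ := mem_image.1 he'
    exact hgH f hf (mem_filter.1 he).1

lemma card_le_of_common_pair {n u t : ℕ} {S p : Finset (Fin n)} (hS : S.card = t)
    (hp : p.card = 2) {E : Finset (Finset (Fin n))} (hE : ∀ e ∈ E, e.card = u + 1 ∧ Disjoint e S)
    (hpE : ∀ e ∈ E, p ⊆ e) : E.card ≤ (n - t - 2).choose (u - 1) := by
  rcases E.eq_empty_or_nonempty with rfl | ⟨e₀, he₀⟩
  · simp
  have hpS : Disjoint p S := (hE e₀ he₀).2.mono_left (hpE e₀ he₀)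
  have hc : (univ \ (S ∪ p)).card = n - t - 2 := by
    rw [card_sdiff_of_subset (subset_univ _), card_union_of_disjoint hpS.symm, card_univ,
      Fintype.card_fin, hS, hp]
    omega
  rw [← hc, ← card_powersetCard]
  refine card_le_card_of_injOn (fun e => e \ p) (fun e he => ?_) fun e he e' he' h => ?_
  · have h1 := card_sdiff_of_subset (hpE e he)
    have h2 := (hE e he).1
    refine mem_powersetCard.2 ⟨fun x hx => ?_, h1.trans (by omega)⟩
    obtain ⟨hxe, hxp⟩ := mem_sdiff.1 hx
    have := disjoint_left.1 (hE e he).2 hxe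
    simp [hxp, this]
  · rw [← sdiff_union_of_subset (hpE e he), ← sdiff_union_of_subset (hpE e' he')]
    exact congrArg (· ∪ p) h

/-- An intersecting family without a common pair in which the members meeting in a single vertex
are otherwise contained in `W` is small. -/
lemma card_le_of_no_common_pair {n u : ℕ} {W : Finset (Fin n)} {E : Finset (Finset (Fin n))}
    (hE : ∀ e ∈ E, e.card = u + 1) (hi : ∀ e ∈ E, ∀ e' ∈ E, ¬ Disjoint e e')
    (h1 : ∀ e ∈ E, ∀ e' ∈ E, (e ∩ e').card = 1 → e \ e' ⊆ W)
    (hp : ∀ p : Finset (Fin n), p.card = 2 → ∃ e ∈ E, ¬ p ⊆ e) :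
    E.card ≤ (u + 1) * W.card ^ u + (u + 1) ^ 3 * n ^ (u - 2) := by
  rcases E.eq_empty_or_nonempty with rfl | ⟨e₁, he₁⟩
  · simp
  choose! g hg hpg using hp
  have hsub : E ⊆ (e₁.biUnion fun v => E.filter fun e => {v} ⊆ e ∧ e \ {v} ⊆ W) ∪
      (powersetCard 2 e₁).biUnion fun p =>
        E.filter fun e => p ⊆ e ∧ ∃ x ∈ g p, x ∉ p ∧ x ∈ e := by
    have hone : ∀ e ∈ E, ∀ e' ∈ E, ∀ v ∈ e₁, e ∩ e' = {v} →
        e ∈ e₁.biUnion fun v => E.filter fun e => {v} ⊆ e ∧ e \ {v} ⊆ W := by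
      intro e he e' he' v hv h
      have h2 := h1 e he e' he' (by rw [h, card_singleton])
      rw [← sdiff_inter_self_left, h] at h2
      exact mem_biUnion.2 ⟨v, hv, mem_filter.2 ⟨he, h ▸ inter_subset_left, h2⟩⟩
    intro e he
    rw [mem_union]
    rcases Nat.lt_or_ge (e ∩ e₁).card 2 with h | h
    · have hpos : 0 < (e ∩ e₁).card :=
        card_pos.2 (not_disjoint_iff_nonempty_inter.1 (hi e he e₁ he₁))
      obtain ⟨v, hv⟩ := card_eq_one.1 (show (e ∩ e₁).card = 1 by omega)
      have hv1 : v ∈ e ∩ e₁ := hv ▸ mem_singleton_self v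
      exact Or.inl (hone e he e₁ he₁ v (mem_inter.1 hv1).2 hv)
    · obtain ⟨p, hpe, hpc⟩ := exists_subset_card_eq h
      by_cases hx : ∃ x ∈ g p, x ∉ p ∧ x ∈ e
      · exact Or.inr (mem_biUnion.2 ⟨p, mem_powersetCard.2 ⟨hpe.trans inter_subset_right, hpc⟩,
          mem_filter.2 ⟨he, hpe.trans inter_subset_left, hx⟩⟩)
      · push Not at hx
        have hsub : e ∩ g p ⊆ p := fun x hx' => by
          by_contra hxp
          exact hx x (mem_inter.1 hx').2 hxp (mem_inter.1 hx').1
        have hlt : (e ∩ g p).card < 2 := by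
          rw [← hpc]
          refine card_lt_card ⟨hsub, fun h => hpg p hpc (h.trans inter_subset_right)⟩
        have hpos : 0 < (e ∩ g p).card :=
          card_pos.2 (not_disjoint_iff_nonempty_inter.1 (hi e he _ (hg p hpc)))
        obtain ⟨v, hv⟩ := card_eq_one.1 (show (e ∩ g p).card = 1 by omega)
        have hv1 : v ∈ e ∩ g p := hv ▸ mem_singleton_self v
        exact Or.inl (hone e he _ (hg p hpc) v (mem_inter.1 (hpe (hsub hv1))).2 hv)
  refine (card_le_card hsub).trans ((card_union_le _ _).trans (add_le_add ?_ ?_))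
  · refine card_biUnion_le.trans ?_
    rw [← hE e₁ he₁, ← smul_eq_mul, ← sum_const]
    refine sum_le_sum fun v _ => ?_
    have := card_filter_superset_le (u + 1) {v} W
      (E.filter fun e => {v} ⊆ e ∧ e \ {v} ⊆ W) fun e he =>
        ⟨hE e (mem_filter.1 he).1, (mem_filter.1 he).2⟩
    simpa using this
  · refine card_biUnion_le.trans ((sum_le_card_nsmul _ _ ((u + 1) * n ^ (u - 2)) ?_).trans ?_)
    · intro p hp
      obtain ⟨-, hpc⟩ := mem_powersetCard.1 hp
      have := card_le_of_meets (u + 1) p (g p)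
        (E.filter fun e => p ⊆ e ∧ ∃ x ∈ g p, x ∉ p ∧ x ∈ e) fun e he =>
          ⟨hE e (mem_filter.1 he).1, (mem_filter.1 he).2⟩
      rwa [hE _ (hg p hpc), hpc, show u + 1 - 2 - 1 = u - 2 by omega] at this
    · rw [card_powersetCard, hE e₁ he₁, smul_eq_mul, ← mul_assoc, pow_succ _ 2]
      gcongr
      exact Nat.choose_le_pow _ _

/-- The upper bound on the number of edges of a large hypergraph without linear paths of
length `2 * t + 2`. -/
theorem eventually_card_le {u t : ℕ} (hu : 2 ≤ u) (ht : 1 ≤ t) :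
    ∀ᶠ n : ℕ in Filter.atTop, ∀ H : Finset (Finset (Fin n)), (∀ e ∈ H, e.card = u + 1) →
      ¬ HasPath H (2 * t + 2) →
      H.card ≤ ∑ i ∈ Icc 1 t, (n - i).choose u + (n - t - 2).choose (u - 1) := by
  obtain ⟨η, hη, hcore⟩ := eventually_exists_core hu ht
  obtain ⟨γ, hγ, hc⟩ := exists_choose_bound (u - 1) (show (0 : ℝ) < 1 / 2 by norm_num)
  set K := (2 * t + 3) * (u + 1) with hK
  have hK0 : (0 : ℝ) < u * K := by
    exact_mod_cast Nat.mul_pos (show 0 < u by omega) (show 0 < K by positivity)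
  set ε := min 1 (η / (u * K)) with hε
  have hε0 : 0 < ε := by positivity
  filter_upwards [hcore ε hε0, hc,
    eventually_lt_mul_pow ((u + 1) ^ 3) (u := u - 1) (by omega) hγ,
    Filter.eventually_ge_atTop (2 * (t + 2))] with n hcore hc hp hn H hH hno
  rcases Nat.lt_or_ge H.card (∑ i ∈ Icc 1 t, (n - i).choose u) with hlt | hge
  · omega
  obtain ⟨S, U, hS, hUS, hflex, hU, hb, hmiss⟩ := hcore H hH hno hge
  set W := univ \ (U ∪ S) with hW
  have hmeet := card_filter_meets_add_card_missedSets_le (S := S) hH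
  rw [card_filter_meets u hS] at hmeet
  have hins : (H.filter fun e => e ⊆ W).card ≤ (2 * t + 2) * (u + 1) * W.card ^ u :=
    card_le_of_not_hasPath (by omega) W _
      (fun e he => ⟨hH e (mem_filter.1 he).1, (mem_filter.1 he).2⟩)
      fun h => hno (h.mono (filter_subset _ _))
  set E := H.filter fun e => Disjoint e S ∧ ¬ Disjoint e U with hE
  have hEm : ∀ e ∈ E, e ∈ H ∧ Disjoint e S ∧ ¬ Disjoint e U := fun e he => mem_filter.1 he
  have hEc : E.card ≤ (n - t - 2).choose (u - 1) + (u + 1) * W.card ^ u := by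
    by_cases hpair : ∃ p : Finset (Fin n), p.card = 2 ∧ ∀ e ∈ E, p ⊆ e
    · obtain ⟨p, hp2, hpE⟩ := hpair
      have := card_le_of_common_pair hS hp2 (E := E) (u := u)
        (fun e he => ⟨hH e (hEm e he).1, (hEm e he).2.1⟩) hpE
      omega
    · push Not at hpair
      have h1 := card_le_of_no_common_pair (W := W) (E := E) (u := u)
        (fun e he => hH e (hEm e he).1)
        (fun e he e' he' hd => by
          obtain ⟨heH, heS, heU⟩ := hEm e he
          obtain ⟨heH', heS', heU'⟩ := hEm e' he'
          obtain ⟨y, hy, hyU⟩ := not_disjoint_iff.1 heU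
          obtain ⟨y', hy', hyU'⟩ := not_disjoint_iff.1 heU'
          exact hno (hflex.hasPath_of_disjoint ht hU hUS hH hS heH heH' heS heS' hd hy hyU
            hy' hyU'))
        (fun e he e' he' h y hy => by
          obtain ⟨heH, heS, -⟩ := hEm e he
          obtain ⟨heH', heS', -⟩ := hEm e' he'
          obtain ⟨hye, hye'⟩ := mem_sdiff.1 hy
          have hyU : y ∉ U := fun hyU => hno (hflex.hasPath_of_card_inter_eq_one hU hH hS heH' heH
            heS' heS (by rwa [inter_comm]) hye hye' hyU)
          simp [hW, hyU, disjoint_left.1 heS hye]) hpair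
      have h2 : (u + 1) ^ 3 * n ^ (u - 2) ≤ (n - t - 2).choose (u - 1) := by
        have h3 := hc (n - t - 2) (by
          rw [Nat.sub_sub, Nat.cast_sub (by omega)]
          have : ((2 * (t + 2) : ℕ) : ℝ) ≤ n := by exact_mod_cast hn
          push_cast at this ⊢
          linarith)
        rw [show u - 1 - 1 = u - 2 by omega] at hp
        exact_mod_cast hp.le.trans h3
      omega
  have hsplit : H.card ≤ (H.filter fun e => ¬ Disjoint e S).card +
      (E.card + (H.filter fun e => e ⊆ W).card) := by
    refine (card_le_card fun e he => ?_).trans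
      ((card_union_le _ _).trans (Nat.add_le_add_left (card_union_le _ _) _))
    simp only [mem_union, hE, mem_filter, he, true_and]
    by_cases hS : Disjoint e S
    · by_cases hU : Disjoint e U
      · refine Or.inr (Or.inr fun x hx => ?_)
        simp [hW, disjoint_left.1 hS hx, disjoint_left.1 hU hx]
      · exact Or.inr (Or.inl ⟨hS, hU⟩)
    · exact Or.inl hS
  have hfin : K * W.card ^ u ≤ (missedSets H S u).card := by
    obtain ⟨w, rfl⟩ : ∃ w, u = w + 2 := ⟨u - 2, by omega⟩
    have h1 : (W.card : ℝ) ^ (w + 1) ≤ ε * (n : ℝ) ^ (w + 1) := by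
      calc (W.card : ℝ) ^ (w + 1) ≤ (ε * n) ^ (w + 1) := by gcongr
        _ = ε ^ (w + 1) * (n : ℝ) ^ (w + 1) := mul_pow _ _ _
        _ ≤ ε * (n : ℝ) ^ (w + 1) := by
          gcongr
          exact pow_le_of_le_one hε0.le (min_le_left _ _) (by omega)
    have h2 : ((w + 2 : ℕ) * K : ℝ) * ε ≤ η := by
      have : ε ≤ η / ((w + 2 : ℕ) * K) := min_le_right _ _
      rwa [le_div_iff₀ hK0, mul_comm] at this
    have hw0 : (0 : ℝ) < (w + 2 : ℕ) := by positivity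
    have h3 : (K : ℝ) * (W.card : ℝ) ^ (w + 2) ≤ (missedSets H S (w + 2)).card := by
      refine le_of_mul_le_mul_left (le_trans ?_ hmiss) hw0
      calc ((w + 2 : ℕ) : ℝ) * (K * (W.card : ℝ) ^ (w + 2))
          = (w + 2 : ℕ) * K * (W.card * (W.card : ℝ) ^ (w + 1)) := by ring
        _ ≤ (w + 2 : ℕ) * K * (W.card * (ε * (n : ℝ) ^ (w + 1))) := by gcongr
        _ = W.card * (((w + 2 : ℕ) * K * ε) * (n : ℝ) ^ (w + 1)) := by ring
        _ ≤ W.card * (η * (n : ℝ) ^ (w + 1)) := by gcongr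
    exact_mod_cast h3
  have hKe : K * W.card ^ u = (2 * t + 2) * (u + 1) * W.card ^ u + (u + 1) * W.card ^ u := by
    rw [hK]
    ring
  omega

lemma card_inter_le_one {n k ℓ : ℕ} {A : Fin ℓ → Finset (Fin n)} (hA : IsLinearPath k ℓ A)
    {i j : Fin ℓ} (hij : i ≠ j) : (A i ∩ A j).card ≤ 1 := by
  have key : ∀ i j : Fin ℓ, (i : ℕ) < j → (A i ∩ A j).card ≤ 1 := by
    intro i j h
    rcases Nat.lt_or_ge ((i : ℕ) + 1) j with h1 | h1
    · simp [disjoint_iff_inter_eq_empty.1 (hA.2.2 i j h1)]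
    · exact (hA.2.1 i j (by omega)).le
  rcases lt_or_gt_of_ne (mt Fin.ext hij) with h | h
  · exact key i j h
  · rw [inter_comm]
    exact key j i h

lemma card_filter_mem_le_two {n k ℓ : ℕ} {A : Fin ℓ → Finset (Fin n)} (hA : IsLinearPath k ℓ A)
    (c : Fin n) : (univ.filter fun i => c ∈ A i).card ≤ 2 := by
  by_contra! h
  obtain ⟨i, j, l, hi, hj, hl, hij, hil, hjl⟩ := two_lt_card_iff.1 h
  have key : ∀ i j, i ∈ univ.filter (fun i => c ∈ A i) → j ∈ univ.filter (fun i => c ∈ A i) →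
      (j : ℕ) ≤ i + 1 := by
    intro i j hi hj
    by_contra! h
    exact disjoint_left.1 (hA.2.2 i j h) (mem_filter.1 hi).2 (mem_filter.1 hj).2
  have h1 := key i j hi hj
  have h2 := key j i hj hi
  have h3 := key i l hi hl
  have h4 := key l i hl hi
  have h5 := key j l hj hl
  have h6 := key l j hl hj
  have := mt Fin.ext hij
  have := mt Fin.ext hil
  have := mt Fin.ext hjl
  omega

lemma not_isLinearPath_of_common_pair {n k t : ℕ} {S p : Finset (Fin n)} (hS : S.card = t)
    (hp : p.card = 2) {A : Fin (2 * t + 2) → Finset (Fin n)}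
    (hA : ∀ i, ¬ Disjoint (A i) S ∨ p ⊆ A i) : ¬ IsLinearPath k (2 * t + 2) A := by
  intro hpath
  have h1 : (univ.filter fun i => ¬ Disjoint (A i) S).card ≤ S.card * 2 := by
    refine (card_le_card (t := S.biUnion fun c => univ.filter fun i => c ∈ A i)
      fun i hi => ?_).trans (card_biUnion_le_card_mul _ _ _ fun c _ =>
        card_filter_mem_le_two hpath c)
    obtain ⟨c, hc, hcS⟩ := not_disjoint_iff.1 (mem_filter.1 hi).2
    exact mem_biUnion.2 ⟨c, hcS, mem_filter.2 ⟨mem_univ _, hc⟩⟩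
  have h2 := card_filter_add_card_filter_not (s := (univ : Finset (Fin (2 * t + 2))))
    (fun i => ¬ Disjoint (A i) S)
  rw [card_univ, Fintype.card_fin] at h2
  obtain ⟨i, hi, j, hj, hij⟩ := one_lt_card.1
    (show 1 < (univ.filter fun i => ¬ ¬ Disjoint (A i) S).card by omega)
  have h3 := card_le_card (subset_inter ((hA i).resolve_left (mem_filter.1 hi).2)
    ((hA j).resolve_left (mem_filter.1 hj).2))
  have h4 := card_inter_le_one hpath hij
  omega

lemma exists_extremal {n u t : ℕ} (hu : 2 ≤ u) (hn : t + 2 ≤ n) :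
    ∃ H : Finset (Finset (Fin n)), (∀ e ∈ H, e.card = u + 1) ∧
      (¬ ∃ A : Fin (2 * t + 2) → Finset (Fin n),
        IsLinearPath (u + 1) (2 * t + 2) A ∧ ∀ i, A i ∈ H) ∧
      H.card = ∑ i ∈ Icc 1 t, (n - i).choose u + (n - t - 2).choose (u - 1) := by
  obtain ⟨S, -, hS⟩ := exists_subset_card_eq
    (show t ≤ (univ : Finset (Fin n)).card by rw [card_univ, Fintype.card_fin]; omega)
  obtain ⟨p, hpS, hp⟩ := exists_subset_card_eq (show 2 ≤ (univ \ S).card by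
    rw [card_sdiff_of_subset (subset_univ _), card_univ, Fintype.card_fin]
    omega)
  have hpS : Disjoint p S := (subset_sdiff.1 hpS).2
  set M := (powersetCard (u + 1) (univ : Finset (Fin n))).filter fun e => ¬ Disjoint e S with hM
  set P := (powersetCard (u + 1) (univ : Finset (Fin n))).filter
    fun e => Disjoint e S ∧ p ⊆ e with hP
  have hPc : P.card = (n - t - 2).choose (u - 1) := by
    refine le_antisymm (card_le_of_common_pair hS hp (fun e he => ?_) fun e he => ?_) ?_
    · obtain ⟨h1, h2⟩ := mem_filter.1 he
      exact ⟨(mem_powersetCard.1 h1).2, h2.1⟩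
    · exact (mem_filter.1 he).2.2
    · have hc : (univ \ (S ∪ p)).card = n - t - 2 := by
        rw [card_sdiff_of_subset (subset_univ _), card_union_of_disjoint hpS.symm, card_univ,
          Fintype.card_fin, hS, hp]
        omega
      rw [← hc, ← card_powersetCard]
      have hd : ∀ g ∈ powersetCard (u - 1) (univ \ (S ∪ p)), Disjoint g S ∧ Disjoint g p :=
        fun g hg => disjoint_union_right.1 (subset_sdiff.1 (mem_powersetCard.1 hg).1).2
      refine card_le_card_of_injOn (fun g => g ∪ p) (fun g hg => ?_) fun g hg g' hg' h => ?_
      · refine mem_filter.2 ⟨mem_powersetCard.2 ⟨subset_univ _, ?_⟩,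
          disjoint_union_left.2 ⟨(hd g hg).1, hpS⟩, subset_union_right⟩
        rw [card_union_of_disjoint (hd g hg).2, (mem_powersetCard.1 hg).2, hp]
        omega
      · rw [← union_sdiff_cancel_right (hd g hg).2, ← union_sdiff_cancel_right (hd g' hg').2]
        exact congrArg (· \ p) h
  refine ⟨M ∪ P, fun e he => ?_, ?_, ?_⟩
  · rcases mem_union.1 he with he | he <;> exact (mem_powersetCard.1 (mem_filter.1 he).1).2
  · rintro ⟨A, hA, hAH⟩
    refine not_isLinearPath_of_common_pair hS hp (fun i => ?_) hA
    rcases mem_union.1 (hAH i) with h | h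
    · exact Or.inl (mem_filter.1 h).2
    · exact Or.inr (mem_filter.1 h).2.2
  · rw [card_union_of_disjoint, hPc, hM, card_filter_meets u hS]
    exact disjoint_left.2 fun e he he' => (mem_filter.1 he).2 (mem_filter.1 he').2.1

end LinearPath

/-- Theorem 1, even case: for `k ≥ 3` and sufficiently large `n`, the Turán number of the `k`-uniform linear path of length `2t+2` is `C(n-1,k-1) + ⋯ + C(n-t,k-1) + C(n-t-2,k-2)`. -/
theorem turan_linear_path_even (k t : ℕ) (hk : 3 ≤ k) (ht : 1 ≤ t) :
    ∃ n₀ : ℕ, ∀ n ≥ n₀,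
      IsGreatest {m : ℕ | ∃ H : Finset (Finset (Fin n)),
          (∀ e ∈ H, e.card = k) ∧
          (¬ ∃ A : Fin (2 * t + 2) → Finset (Fin n),
              IsLinearPath k (2 * t + 2) A ∧ ∀ i, A i ∈ H) ∧
          H.card = m}
        ((∑ i ∈ Finset.Icc 1 t, Nat.choose (n - i) (k - 1)) + Nat.choose (n - t - 2) (k - 2)) := by
  obtain ⟨u, rfl⟩ : ∃ u, k = u + 1 := ⟨k - 1, by omega⟩
  obtain ⟨n₀, hn₀⟩ := Filter.eventually_atTop.1
    (LinearPath.eventually_card_le (u := u) (t := t) (by omega) ht)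
  refine ⟨max n₀ (t + 2), fun n hn => ⟨?_, ?_⟩⟩
  · exact LinearPath.exists_extremal (by omega) ((le_max_right _ _).trans hn)
  · rintro m ⟨H, hH, hA, rfl⟩
    exact hn₀ n ((le_max_left _ _).trans hn) H hH fun h => hA (h.exists_isLinearPath hH)
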